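/- arXiv:1304.7999 — 2 statements merged into one kernel-verified Lean document; each statement's English description precedes it below -/
import Mathlib

section
/- Let A be a finite essential arrangement of affine hyperplanes in ℝⁿ, i.e., the normal vectors of the hyperplanes in A span ℝⁿ. Let L(A) ∪ {1̂} denote the intersection semilattice of A with a maximal element 1̂ adjoined. Then the number of bounded regions of A (bounded connected components of ℝⁿ \ ⋃_{H ∈ A} H) equals |μ(0̂, 1̂)|, the absolute value of the Möbius function of L(A) ∪ {1̂} evaluated on the interval from the minimal element 0̂ = ℝⁿ to the adjoined maximal element 1̂. -/
/-- A set `H ⊆ ℝⁿ` is an affine hyperplane if it is the zero set of a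
nontrivial affine-linear equation `∑ i, a i * x i = b` with `a ≠ 0`. -/
def IsAffineHyperplane {n : ℕ} (H : Set (Fin n → ℝ)) : Prop :=
  ∃ (a : Fin n → ℝ) (b : ℝ), a ≠ 0 ∧ H = {x | ∑ i, a i * x i = b}

/-- The intersection semilattice `L(A)` of an arrangement `A`: all nonempty
intersections `⋂_{H ∈ B} H` for `B ⊆ A` (the empty intersection being `ℝⁿ`). -/
def IntersectionPoset {n : ℕ} (A : Finset (Set (Fin n → ℝ))) : Type :=
  {S : Set (Fin n → ℝ) //
    S.Nonempty ∧ ∃ B : Finset (Set (Fin n → ℝ)), B ⊆ A ∧ S = ⋂ H ∈ B, (H : Set (Fin n → ℝ))}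

/-- `L(A)` is partially ordered by reverse inclusion. -/
instance {n : ℕ} (A : Finset (Set (Fin n → ℝ))) : PartialOrder (IntersectionPoset A) where
  le S T := T.1 ⊆ S.1
  le_refl S := subset_rfl
  le_trans S T U h₁ h₂ := Set.Subset.trans h₂ h₁
  le_antisymm S T h₁ h₂ := Subtype.ext (subset_antisymm h₂ h₁)

instance {n : ℕ} (A : Finset (Set (Fin n → ℝ))) : Finite (IntersectionPoset A) := by
  have h : {S : Set (Fin n → ℝ) |
      S.Nonempty ∧ ∃ B : Finset (Set (Fin n → ℝ)), B ⊆ A ∧ S = ⋂ H ∈ B, (H : Set (Fin n → ℝ))}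
      ⊆ (fun B : Finset (Set (Fin n → ℝ)) => ⋂ H ∈ B, (H : Set (Fin n → ℝ))) ''
        (A.powerset : Set (Finset (Set (Fin n → ℝ)))) := by
    rintro S ⟨-, B, hBA, rfl⟩
    exact ⟨B, by simpa using hBA, rfl⟩
  exact ((A.powerset.finite_toSet.image _).subset h).to_subtype

noncomputable instance {n : ℕ} (A : Finset (Set (Fin n → ℝ))) :
    Fintype (IntersectionPoset A) := Fintype.ofFinite _

noncomputable instance {n : ℕ} (A : Finset (Set (Fin n → ℝ))) :
    Fintype (WithTop (IntersectionPoset A)) :=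
  instFintypeOption

/-- `L(A) ∪ {1̂}`, the intersection semilattice with a maximal element adjoined,
is locally finite, so it carries a Möbius function. -/
noncomputable instance {n : ℕ} (A : Finset (Set (Fin n → ℝ))) :
    LocallyFiniteOrder (WithTop (IntersectionPoset A)) := by
  classical exact Fintype.toLocallyFiniteOrder

/-- The minimal element `0̂ = ℝⁿ` of `L(A)` (the empty intersection). -/
def IntersectionPoset.bot {n : ℕ} (A : Finset (Set (Fin n → ℝ))) : IntersectionPoset A :=
  ⟨Set.univ, Set.univ_nonempty, ∅, by simp, by simp⟩

open scoped Classical in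
theorem sum_mu_bot_Iic {n : ℕ} (A : Finset (Set (Fin n → ℝ))) (X : IntersectionPoset A) :
    ∑ Y : IntersectionPoset A with Y ≤ X,
      IncidenceAlgebra.mu ℤ (IntersectionPoset.bot A : WithTop (IntersectionPoset A)) Y =
      if IntersectionPoset.bot A = X then 1 else 0 := by
  have h := IncidenceAlgebra.sum_Icc_mu_right (𝕜 := ℤ)
    (IntersectionPoset.bot A : WithTop (IntersectionPoset A)) (X : WithTop (IntersectionPoset A))
  simp only [WithTop.coe_inj] at h
  rw [← h]
  refine (Finset.sum_map (Finset.univ.filter (· ≤ X)) ⟨WithTop.some, WithTop.coe_injective⟩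
    (IncidenceAlgebra.mu ℤ _)).symm.trans ?_
  congr 1
  ext Y
  induction Y using WithTop.recTopCoe with
  | top => simp
  | coe Y =>
    have : IntersectionPoset.bot A ≤ Y := Set.subset_univ Y.1
    simp [this]

open scoped Classical in
theorem sum_neg_one_pow_card_Iic {n : ℕ} (A : Finset (Set (Fin n → ℝ)))
    (hA : ∀ H ∈ A, H ≠ Set.univ) (X : IntersectionPoset A) :
    ∑ Y : IntersectionPoset A with Y ≤ X,
      ∑ B ∈ A.powerset with (⋂ H ∈ B, H) = Y.1, (-1 : ℤ) ^ B.card =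
      if IntersectionPoset.bot A = X then 1 else 0 := by
  have h : ∑ Y : IntersectionPoset A with Y ≤ X,
      ∑ B ∈ A.powerset with (⋂ H ∈ B, H) = Y.1, (-1 : ℤ) ^ B.card =
      ∑ B ∈ (A.filter (X.1 ⊆ ·)).powerset, (-1 : ℤ) ^ B.card := by
    rw [← Finset.sum_biUnion]
    · congr 1
      ext B
      simp only [Finset.mem_biUnion, Finset.mem_filter, Finset.mem_univ, true_and,
        Finset.mem_powerset]
      constructor
      · rintro ⟨Y, hY, hB, hBY⟩ H hH
        refine Finset.mem_filter.2 ⟨hB hH, ?_⟩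
        have hY' : X.1 ⊆ Y.1 := hY
        rw [← hBY] at hY'
        exact hY'.trans (Set.biInter_subset_of_mem hH)
      · intro hB
        have hXB : X.1 ⊆ ⋂ H ∈ B, H :=
          Set.subset_iInter₂ fun H hH => (Finset.mem_filter.1 (hB hH)).2
        have hBA : B ⊆ A := hB.trans (Finset.filter_subset _ _)
        exact ⟨⟨⋂ H ∈ B, H, X.2.1.mono hXB, B, hBA, rfl⟩, hXB, hBA, rfl⟩
    · intro Y _ Z _ hYZ
      refine Finset.disjoint_left.2 fun B hY hZ => hYZ (Subtype.ext ?_)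
      rw [← (Finset.mem_filter.1 hY).2, ← (Finset.mem_filter.1 hZ).2]
  rw [h, Finset.sum_powerset_neg_one_pow_card]
  congr 1
  rw [eq_iff_iff, Finset.filter_eq_empty_iff]
  constructor
  · intro hX
    obtain ⟨B, hBA, hB⟩ := X.2.2
    have hBe : B = ∅ := by
      refine Finset.eq_empty_of_forall_notMem fun H hH => hX (hBA hH) ?_
      rw [hB]
      exact Set.biInter_subset_of_mem hH
    refine Subtype.ext ?_
    rw [hB, hBe]
    simp [IntersectionPoset.bot]
  · rintro rfl H hH hs
    exact hA H hH (Set.univ_subset_iff.1 hs)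

open scoped Classical in
theorem mu_bot_coe {n : ℕ} (A : Finset (Set (Fin n → ℝ)))
    (hA : ∀ H ∈ A, H ≠ Set.univ) (X : IntersectionPoset A) :
    IncidenceAlgebra.mu ℤ (IntersectionPoset.bot A : WithTop (IntersectionPoset A)) X =
      ∑ B ∈ A.powerset with (⋂ H ∈ B, H) = X.1, (-1 : ℤ) ^ B.card := by
  induction X using WellFoundedLT.induction with
  | ind X ih =>
    have h := (sum_mu_bot_Iic A X).trans (sum_neg_one_pow_card_Iic A hA X).symm
    have hX : X ∈ Finset.univ.filter (· ≤ X) := by simp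
    rw [← Finset.add_sum_erase _ _ hX, ← Finset.add_sum_erase _ _ hX] at h
    rw [Finset.sum_congr rfl fun Y hY => ih Y ?_] at h
    · exact add_right_cancel h
    · simp only [Finset.mem_erase, Finset.mem_filter, Finset.mem_univ, true_and] at hY
      exact lt_of_le_of_ne hY.2 hY.1

open scoped Classical in
/-- The Möbius number of `L(A) ∪ {1̂}` as an alternating sum over the central subarrangements. -/
theorem mu_bot_top {n : ℕ} (A : Finset (Set (Fin n → ℝ))) (hA : ∀ H ∈ A, H ≠ Set.univ) :
    IncidenceAlgebra.mu ℤ (IntersectionPoset.bot A : WithTop (IntersectionPoset A)) ⊤ =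
      -∑ B ∈ A.powerset with (⋂ H ∈ B, H).Nonempty, (-1 : ℤ) ^ B.card := by
  have h := IncidenceAlgebra.sum_Icc_mu_right (𝕜 := ℤ)
    (IntersectionPoset.bot A : WithTop (IntersectionPoset A)) ⊤
  have hu : Finset.Icc (IntersectionPoset.bot A : WithTop (IntersectionPoset A)) ⊤ =
      insert ⊤ ((Finset.univ : Finset (IntersectionPoset A)).map
        ⟨WithTop.some, WithTop.coe_injective⟩) := by
    ext Y
    induction Y using WithTop.recTopCoe with
    | top => simp
    | coe Y =>
      have : IntersectionPoset.bot A ≤ Y := Set.subset_univ Y.1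
      simp [this]
  rw [hu, Finset.sum_insert (by simp), Finset.sum_map, if_neg (by simp)] at h
  rw [eq_neg_of_add_eq_zero_left h, neg_inj]
  simp only [Function.Embedding.coeFn_mk]
  rw [Finset.sum_congr rfl fun X _ => mu_bot_coe A hA X, ← Finset.sum_biUnion]
  · congr 1
    ext B
    simp only [Finset.mem_biUnion, Finset.mem_filter, Finset.mem_univ, true_and]
    constructor
    · rintro ⟨X, hB, hX⟩
      exact ⟨hB, hX ▸ X.2.1⟩
    · rintro ⟨hB, hX⟩
      exact ⟨⟨_, hX, B, Finset.mem_powerset.1 hB, rfl⟩, hB, rfl⟩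
  · intro Y _ Z _ hYZ
    refine Finset.disjoint_left.2 fun B hY hZ => hYZ (Subtype.ext ?_)
    rw [← (Finset.mem_filter.1 hY).2, ← (Finset.mem_filter.1 hZ).2]

theorem ite_and_of_left {N G : Prop} [Decidable N] [Decidable G] (h : N) (e : ℤ) :
    (if N ∧ G then e else 0) = if G then e else 0 :=
  if_congr (and_iff_right h) rfl rfl

theorem ite_and_of_not_left {N G : Prop} [Decidable N] [Decidable G] (h : ¬N) (e : ℤ) :
    (if N ∧ G then e else 0) = 0 :=
  if_neg fun k => h k.1

theorem ite_neg_add_ite_neg {G G₀ G₁ G₂ : Prop} [Decidable G] [Decidable G₀] [Decidable G₁]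
    [Decidable G₂] (e : ℤ) (h : G ↔ G₁ ∧ G₂) (h₀ : G₀ ↔ G₁ ∨ G₂) :
    ((if G₁ then -e else 0) + if G₂ then -e else 0) =
      (if G then -e else 0) - if G₀ then e else 0 := by
  by_cases h₁ : G₁ <;> by_cases h₂ : G₂ <;> simp [h, h₀, h₁, h₂, sub_eq_add_neg]

section Polyhedra

variable {V : Type*} [AddCommGroup V] [Module ℝ V]

/-- The relatively open polyhedron cut out by the equations `p = 0`, `p ∈ E`, and the strict
inequalities `0 < p`, `p ∈ P`; a pair `p = (g, b)` stands for the affine function `g + b`. -/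
def openPolyhedron (E P : Set (Module.Dual ℝ V × ℝ)) : Set V :=
  {x | (∀ p ∈ E, p.1 x + p.2 = 0) ∧ ∀ p ∈ P, 0 < p.1 x + p.2}

/-- The common kernel of the linear parts of a set of affine functions. -/
def directionSpace (E : Set (Module.Dual ℝ V × ℝ)) : Submodule ℝ V :=
  ⨅ p ∈ E, LinearMap.ker p.1

/-- The recession cone of (the closure of) `openPolyhedron E P`. -/
def recessionCone (E P : Set (Module.Dual ℝ V × ℝ)) : Set V :=
  {v | (∀ p ∈ E, p.1 v = 0) ∧ ∀ p ∈ P, 0 ≤ p.1 v}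

open scoped Classical in
/-- The valuation of `openPolyhedron E P` that vanishes unless the polyhedron is nonempty and
bounded modulo its lineality space, and is the sign of the dimension modulo lineality otherwise. -/
noncomputable def polyhedronEuler (E P : Set (Module.Dual ℝ V × ℝ)) : ℤ :=
  if (openPolyhedron E P).Nonempty ∧ ∀ v ∈ recessionCone E P, v ∈ directionSpace (E ∪ P) then
    (-1) ^ (Module.finrank ℝ (directionSpace E) + Module.finrank ℝ (directionSpace (E ∪ P)))
  else 0

variable {E P : Set (Module.Dual ℝ V × ℝ)} {p : Module.Dual ℝ V × ℝ} {x v : V}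

theorem mem_directionSpace : v ∈ directionSpace E ↔ ∀ p ∈ E, p.1 v = 0 := by
  simp [directionSpace]

theorem mem_openPolyhedron_insert_right :
    x ∈ openPolyhedron E (insert p P) ↔ x ∈ openPolyhedron E P ∧ 0 < p.1 x + p.2 := by
  simp only [openPolyhedron, Set.mem_ofPred_eq, Set.forall_mem_insert]
  tauto

theorem mem_openPolyhedron_insert_neg_right :
    x ∈ openPolyhedron E (insert (-p) P) ↔ x ∈ openPolyhedron E P ∧ p.1 x + p.2 < 0 := by
  rw [mem_openPolyhedron_insert_right]
  refine and_congr_right fun _ => ?_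
  simp only [Prod.fst_neg, Prod.snd_neg, LinearMap.neg_apply]
  constructor <;> intro h <;> linarith

theorem mem_openPolyhedron_insert_left :
    x ∈ openPolyhedron (insert p E) P ↔ x ∈ openPolyhedron E P ∧ p.1 x + p.2 = 0 := by
  simp only [openPolyhedron, Set.mem_ofPred_eq, Set.forall_mem_insert]
  tauto

theorem mem_recessionCone_insert_right :
    v ∈ recessionCone E (insert p P) ↔ v ∈ recessionCone E P ∧ 0 ≤ p.1 v := by
  simp only [recessionCone, Set.mem_ofPred_eq, Set.forall_mem_insert]
  tauto

theorem mem_recessionCone_insert_neg_right :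
    v ∈ recessionCone E (insert (-p) P) ↔ v ∈ recessionCone E P ∧ p.1 v ≤ 0 := by
  rw [mem_recessionCone_insert_right]
  simp

theorem mem_recessionCone_insert_left :
    v ∈ recessionCone (insert p E) P ↔ v ∈ recessionCone E P ∧ p.1 v = 0 := by
  simp only [recessionCone, Set.mem_ofPred_eq, Set.forall_mem_insert]
  tauto

theorem directionSpace_insert :
    directionSpace (insert p E) = directionSpace E ⊓ LinearMap.ker p.1 := by
  ext v
  simp only [mem_directionSpace, Set.forall_mem_insert, Submodule.mem_inf, LinearMap.mem_ker]
  tauto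

theorem directionSpace_insert_neg :
    directionSpace (insert (-p) E) = directionSpace E ⊓ LinearMap.ker p.1 := by
  rw [directionSpace_insert]
  ext v
  simp

theorem mem_recessionCone_of_mem_directionSpace (hv : v ∈ directionSpace (E ∪ P)) :
    v ∈ recessionCone E P := by
  rw [mem_directionSpace] at hv
  exact ⟨fun p hp => hv p (Or.inl hp), fun p hp => (hv p (Or.inr hp)).ge⟩

theorem mem_directionSpace_of_mem_recessionCone (hv : v ∈ recessionCone E P) :
    v ∈ directionSpace E :=
  mem_directionSpace.2 hv.1

theorem add_smul_mem_recessionCone {u : V} {t : ℝ} (hu : u ∈ recessionCone E P)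
    (hv : v ∈ recessionCone E P) (ht : 0 ≤ t) : u + t • v ∈ recessionCone E P := by
  constructor
  · intro p hp
    simp [hu.1 p hp, hv.1 p hp]
  · intro p hp
    have := mul_nonneg ht (hv.2 p hp)
    simpa using add_nonneg (hu.2 p hp) this

theorem add_smul_mem_openPolyhedron {t : ℝ} (hx : x ∈ openPolyhedron E P)
    (hv : v ∈ recessionCone E P) (ht : 0 ≤ t) : x + t • v ∈ openPolyhedron E P := by
  constructor
  · intro p hp
    simpa [hv.1 p hp] using hx.1 p hp
  · intro p hp
    have h₁ := mul_nonneg ht (hv.2 p hp)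
    have h₂ := hx.2 p hp
    simp only [map_add, map_smul, smul_eq_mul]
    linarith

theorem convex_openPolyhedron : Convex ℝ (openPolyhedron E P) := by
  intro x hx y hy a b ha hb hab
  have key : ∀ p : Module.Dual ℝ V × ℝ,
      p.1 (a • x + b • y) + p.2 = a * (p.1 x + p.2) + b * (p.1 y + p.2) := by
    intro p
    simp only [map_add, map_smul, smul_eq_mul]
    linear_combination (-p.2) * hab
  constructor
  · intro p hp
    rw [key, hx.1 p hp, hy.1 p hp]
    simp
  · intro p hp
    rw [key]
    have h₁ := hx.2 p hp
    have h₂ := hy.2 p hp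
    rcases ha.eq_or_lt with rfl | ha
    · have : b = 1 := by linarith
      subst this
      linarith
    · have := mul_pos ha h₁
      have := mul_nonneg hb h₂.le
      linarith

theorem exists_pos_add_smul_mem_openPolyhedron (hP : P.Finite) (hx : x ∈ openPolyhedron E P)
    (hv : v ∈ directionSpace E) : ∃ t : ℝ, 0 < t ∧ x + t • v ∈ openPolyhedron E P := by
  have h : ∀ᶠ t in nhdsWithin (0 : ℝ) (Set.Ioi 0), ∀ p ∈ P, 0 < p.1 x + p.2 + t * p.1 v := by
    rw [Filter.eventually_all_finite hP]
    intro p hp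
    have hc : Filter.Tendsto (fun t : ℝ => p.1 x + p.2 + t * p.1 v)
        (nhdsWithin 0 (Set.Ioi 0)) (nhds (p.1 x + p.2 + 0 * p.1 v)) :=
      (Continuous.tendsto (by fun_prop) 0).mono_left nhdsWithin_le_nhds
    exact hc.eventually_const_lt (by simpa using hx.2 p hp)
  obtain ⟨t, ht, ht0⟩ := (h.and self_mem_nhdsWithin).exists
  refine ⟨t, ht0, fun p hp => ?_, fun p hp => ?_⟩
  · simpa [mem_directionSpace.1 hv p hp] using hx.1 p hp
  · have := ht p hp
    simp only [map_add, map_smul, smul_eq_mul]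
    linarith

theorem finrank_inf_ker_add_one [FiniteDimensional ℝ V] {W : Submodule ℝ V}
    {g : Module.Dual ℝ V} (h : ∃ w ∈ W, g w ≠ 0) :
    Module.finrank ℝ ↥(W ⊓ LinearMap.ker g) + 1 = Module.finrank ℝ W := by
  have hg : (g.comp W.subtype : Module.Dual ℝ W) ≠ 0 := by
    obtain ⟨w, hw, hgw⟩ := h
    exact fun h0 => hgw (LinearMap.congr_fun h0 (⟨w, hw⟩ : W))
  rw [← Module.Dual.finrank_ker_add_one_of_ne_zero hg, LinearMap.ker_comp,
    ← Submodule.map_comap_subtype, Submodule.finrank_map_subtype_eq]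

theorem polyhedronEuler_eq_ite {Q : Prop} [Decidable Q] {W L : Submodule ℝ V}
    (hQ : (openPolyhedron E P).Nonempty ∧
      (∀ v ∈ recessionCone E P, v ∈ directionSpace (E ∪ P)) ↔ Q)
    (hW : directionSpace E = W) (hL : directionSpace (E ∪ P) = L) :
    polyhedronEuler E P = if Q then (-1) ^ (Module.finrank ℝ W + Module.finrank ℝ L) else 0 := by
  subst hW hL
  classical
  unfold polyhedronEuler
  exact if_congr hQ rfl rfl

open scoped Classical in
theorem polyhedronEuler_insert_right :
    polyhedronEuler E (insert p P) =
      if (openPolyhedron E (insert p P)).Nonempty ∧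
        ∀ v, v ∈ recessionCone E P ∧ 0 ≤ p.1 v → v ∈ directionSpace (E ∪ P) ⊓ LinearMap.ker p.1
      then (-1) ^ (Module.finrank ℝ (directionSpace E) +
        Module.finrank ℝ ↥(directionSpace (E ∪ P) ⊓ LinearMap.ker p.1)) else 0 := by
  have h : directionSpace (E ∪ insert p P) = directionSpace (E ∪ P) ⊓ LinearMap.ker p.1 := by
    rw [Set.union_insert, directionSpace_insert]
  exact polyhedronEuler_eq_ite (by rw [h]; simp only [mem_recessionCone_insert_right]) rfl h

open scoped Classical in
theorem polyhedronEuler_insert_neg_right :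
    polyhedronEuler E (insert (-p) P) =
      if (openPolyhedron E (insert (-p) P)).Nonempty ∧
        ∀ v, v ∈ recessionCone E P ∧ p.1 v ≤ 0 → v ∈ directionSpace (E ∪ P) ⊓ LinearMap.ker p.1
      then (-1) ^ (Module.finrank ℝ (directionSpace E) +
        Module.finrank ℝ ↥(directionSpace (E ∪ P) ⊓ LinearMap.ker p.1)) else 0 := by
  have h : directionSpace (E ∪ insert (-p) P) = directionSpace (E ∪ P) ⊓ LinearMap.ker p.1 := by
    rw [Set.union_insert, directionSpace_insert_neg]
  exact polyhedronEuler_eq_ite (by rw [h]; simp only [mem_recessionCone_insert_neg_right]) rfl h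

open scoped Classical in
theorem polyhedronEuler_insert_left :
    polyhedronEuler (insert p E) P =
      if (openPolyhedron (insert p E) P).Nonempty ∧
        ∀ v, v ∈ recessionCone E P ∧ p.1 v = 0 → v ∈ directionSpace (E ∪ P) ⊓ LinearMap.ker p.1
      then (-1) ^ (Module.finrank ℝ ↥(directionSpace E ⊓ LinearMap.ker p.1) +
        Module.finrank ℝ ↥(directionSpace (E ∪ P) ⊓ LinearMap.ker p.1)) else 0 := by
  have h : directionSpace (insert p E ∪ P) = directionSpace (E ∪ P) ⊓ LinearMap.ker p.1 := by
    rw [Set.insert_union, directionSpace_insert]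
  exact polyhedronEuler_eq_ite (by rw [h]; simp only [mem_recessionCone_insert_left])
    directionSpace_insert h

open scoped Classical in
theorem polyhedronEuler_of_ker_eq (h : ∀ v ∈ directionSpace E, p.1 v = 0) :
    polyhedronEuler E (insert p P) + polyhedronEuler E (insert (-p) P) =
      polyhedronEuler E P - polyhedronEuler (insert p E) P := by
  have hW : directionSpace E ⊓ LinearMap.ker p.1 = directionSpace E := inf_eq_left.2 h
  have hL : directionSpace (E ∪ P) ⊓ LinearMap.ker p.1 = directionSpace (E ∪ P) :=
    inf_eq_left.2 fun v hv => h v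
      (mem_directionSpace_of_mem_recessionCone (mem_recessionCone_of_mem_directionSpace hv))
  have hC : ∀ v ∈ recessionCone E P, p.1 v = 0 := fun v hv =>
    h v (mem_directionSpace_of_mem_recessionCone hv)
  have hG : ∀ r : V → Prop, (∀ v ∈ recessionCone E P, r v) →
      ((∀ v, v ∈ recessionCone E P ∧ r v → v ∈ directionSpace (E ∪ P)) ↔
        ∀ v ∈ recessionCone E P, v ∈ directionSpace (E ∪ P)) := fun r hr =>
    forall_congr' fun v => by rw [and_iff_left_of_imp (hr v)]
  rw [polyhedronEuler_insert_right, polyhedronEuler_insert_neg_right, polyhedronEuler_insert_left,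
    hW, hL, hG _ fun v hv => (hC v hv).ge, hG _ fun v hv => (hC v hv).le, hG _ hC,
    polyhedronEuler_eq_ite Iff.rfl rfl rfl]
  have hN₁ : (openPolyhedron E (insert p P)).Nonempty ↔
      ∃ y, y ∈ openPolyhedron E P ∧ 0 < p.1 y + p.2 :=
    exists_congr fun _ => mem_openPolyhedron_insert_right
  have hN₂ : (openPolyhedron E (insert (-p) P)).Nonempty ↔
      ∃ y, y ∈ openPolyhedron E P ∧ p.1 y + p.2 < 0 :=
    exists_congr fun _ => mem_openPolyhedron_insert_neg_right
  have hN₃ : (openPolyhedron (insert p E) P).Nonempty ↔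
      ∃ y, y ∈ openPolyhedron E P ∧ p.1 y + p.2 = 0 :=
    exists_congr fun _ => mem_openPolyhedron_insert_left
  rw [hN₁, hN₂, hN₃]
  rcases (openPolyhedron E P).eq_empty_or_nonempty with h0 | ⟨x, hx⟩
  · simp [h0]
  have hconst : ∀ y ∈ openPolyhedron E P, p.1 y = p.1 x := by
    intro y hy
    rw [← sub_eq_zero, ← map_sub]
    refine h _ (mem_directionSpace.2 fun q hq => ?_)
    rw [map_sub]
    linarith [hx.1 q hq, hy.1 q hq]
  have hN : ∀ (r : ℝ → Prop), (∃ y, y ∈ openPolyhedron E P ∧ r (p.1 y + p.2)) ↔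
      r (p.1 x + p.2) := fun r =>
    ⟨fun ⟨y, hy, hr⟩ => hconst y hy ▸ hr, fun hr => ⟨x, hx, hr⟩⟩
  have hNe : (openPolyhedron E P).Nonempty := ⟨x, hx⟩
  rw [hN (0 < ·), hN (· < 0), hN (· = 0)]
  rw [ite_and_of_left hNe]
  rcases lt_trichotomy (p.1 x + p.2) 0 with h' | h' | h'
  · rw [ite_and_of_left h', ite_and_of_not_left h'.not_gt, ite_and_of_not_left h'.ne]
    ring
  · rw [ite_and_of_left h', ite_and_of_not_left h'.not_lt, ite_and_of_not_left h'.not_gt]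
    ring
  · rw [ite_and_of_left h', ite_and_of_not_left h'.not_gt, ite_and_of_not_left h'.ne']
    ring

open scoped Classical in
theorem polyhedronEuler_of_exists_mem_lineality [FiniteDimensional ℝ V]
    (h : ∃ u ∈ directionSpace (E ∪ P), p.1 u ≠ 0) :
    polyhedronEuler E (insert p P) + polyhedronEuler E (insert (-p) P) =
      polyhedronEuler E P - polyhedronEuler (insert p E) P := by
  have hs : ∀ r : ℝ, ∃ u ∈ directionSpace (E ∪ P), p.1 u = r := by
    intro r
    obtain ⟨u, hu, hpu⟩ := h
    exact ⟨(r / p.1 u) • u, Submodule.smul_mem _ _ hu, by simp [hpu]⟩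
  have hW : ∃ u ∈ directionSpace E, p.1 u ≠ 0 := by
    obtain ⟨u, hu, hpu⟩ := h
    exact ⟨u, mem_directionSpace_of_mem_recessionCone
      (mem_recessionCone_of_mem_directionSpace hu), hpu⟩
  have h₁ : polyhedronEuler E (insert p P) = 0 := by
    refine if_neg fun ⟨_, hC⟩ => ?_
    obtain ⟨u, hu, hpu⟩ := hs 1
    have := hC u (mem_recessionCone_insert_right.2
      ⟨mem_recessionCone_of_mem_directionSpace hu, by simp [hpu]⟩)
    simp [Set.union_insert, directionSpace_insert, hpu] at this
  have h₂ : polyhedronEuler E (insert (-p) P) = 0 := by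
    refine if_neg fun ⟨_, hC⟩ => ?_
    obtain ⟨u, hu, hpu⟩ := hs (-1)
    have := hC u (mem_recessionCone_insert_neg_right.2
      ⟨mem_recessionCone_of_mem_directionSpace hu, by simp [hpu]⟩)
    simp [Set.union_insert, directionSpace_insert_neg, hpu] at this
  have hN : (openPolyhedron (insert p E) P).Nonempty ↔ (openPolyhedron E P).Nonempty := by
    refine ⟨fun ⟨x, hx⟩ => ⟨x, (mem_openPolyhedron_insert_left.1 hx).1⟩, fun ⟨x, hx⟩ => ?_⟩
    obtain ⟨u, hu, hpu⟩ := hs (-(p.1 x + p.2))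
    refine ⟨x + (1 : ℝ) • u, mem_openPolyhedron_insert_left.2 ⟨add_smul_mem_openPolyhedron hx
      (mem_recessionCone_of_mem_directionSpace hu) zero_le_one, ?_⟩⟩
    rw [one_smul, map_add, hpu]
    ring
  have hG : (∀ v ∈ recessionCone (insert p E) P, v ∈ directionSpace (insert p E ∪ P)) ↔
      ∀ v ∈ recessionCone E P, v ∈ directionSpace (E ∪ P) := by
    simp only [mem_recessionCone_insert_left, Set.insert_union, directionSpace_insert,
      Submodule.mem_inf, LinearMap.mem_ker]
    refine ⟨fun hC v hv => ?_, fun hC v hv => ⟨hC v hv.1, hv.2⟩⟩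
    obtain ⟨u, hu, hpu⟩ := hs (-p.1 v)
    have := hC (v + (1 : ℝ) • u) ⟨add_smul_mem_recessionCone hv
      (mem_recessionCone_of_mem_directionSpace hu) zero_le_one, by simp [hpu]⟩
    rw [one_smul] at this
    exact (Submodule.add_mem_iff_left _ hu).1 this.1
  have h₃ : polyhedronEuler (insert p E) P = polyhedronEuler E P := by
    rw [polyhedronEuler_eq_ite (and_congr hN hG) directionSpace_insert
      ((congrArg _ Set.insert_union).trans directionSpace_insert),
      polyhedronEuler_eq_ite Iff.rfl rfl rfl, ← finrank_inf_ker_add_one h, ← finrank_inf_ker_add_one hW]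
    congr 1
    ring
  rw [h₁, h₂, h₃]
  simp

open scoped Classical in
theorem polyhedronEuler_of_lineality_le [FiniteDimensional ℝ V] (hP : P.Finite)
    (hL : ∀ u ∈ directionSpace (E ∪ P), p.1 u = 0) (hW : ∃ w ∈ directionSpace E, p.1 w ≠ 0) :
    polyhedronEuler E (insert p P) + polyhedronEuler E (insert (-p) P) =
      polyhedronEuler E P - polyhedronEuler (insert p E) P := by
  have hL' : directionSpace (E ∪ P) ⊓ LinearMap.ker p.1 = directionSpace (E ∪ P) :=
    inf_eq_left.2 hL
  have hε : ∀ l : ℕ, (-1 : ℤ) ^ (Module.finrank ℝ (directionSpace E) + l) =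
      -(-1) ^ (Module.finrank ℝ ↥(directionSpace E ⊓ LinearMap.ker p.1) + l) := by
    intro l
    rw [← finrank_inf_ker_add_one hW]
    ring
  rw [polyhedronEuler_insert_right, polyhedronEuler_insert_neg_right, polyhedronEuler_insert_left,
    polyhedronEuler, hL', hε]
  have hp₁ : ∃ w ∈ directionSpace E, 0 < p.1 w := by
    obtain ⟨w, hw, hpw⟩ := hW
    rcases hpw.lt_or_gt with h | h
    · exact ⟨-w, neg_mem hw, by simpa using h⟩
    · exact ⟨w, hw, h⟩
  -- positive and negative sides of a cell meeting the hyperplane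
  have hN₀ : (openPolyhedron (insert p E) P).Nonempty →
      (openPolyhedron E (insert p P)).Nonempty ∧ (openPolyhedron E (insert (-p) P)).Nonempty := by
    rintro ⟨x, hx⟩
    obtain ⟨hx, hpx⟩ := mem_openPolyhedron_insert_left.1 hx
    obtain ⟨w, hw, hpw⟩ := hp₁
    obtain ⟨t, ht, hxt⟩ := exists_pos_add_smul_mem_openPolyhedron hP hx hw
    obtain ⟨s, hs, hxs⟩ := exists_pos_add_smul_mem_openPolyhedron hP hx (neg_mem hw)
    refine ⟨⟨_, mem_openPolyhedron_insert_right.2 ⟨hxt, ?_⟩⟩,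
      ⟨_, mem_openPolyhedron_insert_neg_right.2 ⟨hxs, ?_⟩⟩⟩
    · simp only [map_add, map_smul, smul_eq_mul]
      linarith [mul_pos ht hpw]
    · simp only [map_add, map_smul, smul_eq_mul, map_neg]
      linarith [mul_pos hs hpw]
  have hN : (openPolyhedron E P).Nonempty ↔ (openPolyhedron (insert p E) P).Nonempty ∨
      (openPolyhedron E (insert p P)).Nonempty ∨ (openPolyhedron E (insert (-p) P)).Nonempty := by
    simp only [Set.Nonempty, mem_openPolyhedron_insert_right,
      mem_openPolyhedron_insert_left, ← exists_or, ← and_or_left]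
    refine exists_congr fun x => (and_iff_left ?_).symm
    rcases lt_trichotomy (p.1 x + p.2) 0 with h | h | h
    · refine Or.inr (Or.inr ?_)
      simp only [Prod.fst_neg, Prod.snd_neg, LinearMap.neg_apply]
      linarith
    · exact Or.inl h
    · exact Or.inr (Or.inl h)
  have hNN : (openPolyhedron E (insert p P)).Nonempty →
      (openPolyhedron E (insert (-p) P)).Nonempty →
      (openPolyhedron (insert p E) P).Nonempty := by
    rintro ⟨x, hx⟩ ⟨y, hy⟩
    obtain ⟨hx, hpx⟩ := mem_openPolyhedron_insert_right.1 hx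
    obtain ⟨hy, hpy⟩ := mem_openPolyhedron_insert_neg_right.1 hy
    set a := p.1 x + p.2 with ha
    set b := p.1 y + p.2 with hb
    have hab : 0 < a - b := by linarith
    refine ⟨(-b / (a - b)) • x + (a / (a - b)) • y, mem_openPolyhedron_insert_left.2
      ⟨convex_openPolyhedron hx hy (div_nonneg (by linarith) hab.le)
        (div_nonneg hpx.le hab.le) (by field_simp; ring), ?_⟩⟩
    have e₁ : p.1 x = a - p.2 := by linarith
    have e₂ : p.1 y = b - p.2 := by linarith
    simp only [map_add, map_smul, smul_eq_mul, e₁, e₂]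
    field_simp
    ring
  -- a cell on one side of the hyperplane recedes on that side
  have hR₁ : (openPolyhedron E (insert p P)).Nonempty →
      ¬ (openPolyhedron (insert p E) P).Nonempty → ∀ v ∈ recessionCone E P, 0 ≤ p.1 v := by
    rintro ⟨x, hx⟩ h v hv
    obtain ⟨hx, hpx⟩ := mem_openPolyhedron_insert_right.1 hx
    by_contra! hlt
    refine h ⟨x + ((p.1 x + p.2) / (-p.1 v)) • v, mem_openPolyhedron_insert_left.2
      ⟨add_smul_mem_openPolyhedron hx hv (div_nonneg hpx.le (by linarith)), ?_⟩⟩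
    have hne := hlt.ne
    simp only [map_add, map_smul, smul_eq_mul]
    field_simp
    ring
  have hR₂ : (openPolyhedron E (insert (-p) P)).Nonempty →
      ¬ (openPolyhedron (insert p E) P).Nonempty → ∀ v ∈ recessionCone E P, p.1 v ≤ 0 := by
    rintro ⟨x, hx⟩ h v hv
    obtain ⟨hx, hpx⟩ := mem_openPolyhedron_insert_neg_right.1 hx
    by_contra! hlt
    refine h ⟨x + (-(p.1 x + p.2) / p.1 v) • v, mem_openPolyhedron_insert_left.2
      ⟨add_smul_mem_openPolyhedron hx hv (div_nonneg (by linarith) hlt.le), ?_⟩⟩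
    simp only [map_add, map_smul, smul_eq_mul]
    field_simp
    ring
  have hG : (∀ v, v ∈ recessionCone E P ∧ p.1 v = 0 → v ∈ directionSpace (E ∪ P)) →
      (∀ v, v ∈ recessionCone E P ∧ 0 ≤ p.1 v → v ∈ directionSpace (E ∪ P)) ∨
      (∀ v, v ∈ recessionCone E P ∧ p.1 v ≤ 0 → v ∈ directionSpace (E ∪ P)) := by
    intro h0
    by_contra! hcon
    obtain ⟨⟨u, ⟨hu, hpu⟩, huL⟩, ⟨v, ⟨hv, hpv⟩, hvL⟩⟩ := hcon
    have hpu' : 0 < p.1 u := hpu.lt_of_ne fun h => huL (h0 u ⟨hu, h.symm⟩)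
    have hpv' : p.1 v < 0 := hpv.lt_of_ne fun h => hvL (h0 v ⟨hv, h⟩)
    have ht : 0 < p.1 u / (-p.1 v) := div_pos hpu' (by linarith)
    have hne := hpv'.ne
    have hw := h0 (u + (p.1 u / (-p.1 v)) • v) ⟨add_smul_mem_recessionCone hu hv ht.le, by
      simp only [map_add, map_smul, smul_eq_mul]
      field_simp
      ring⟩
    rw [mem_directionSpace] at hw
    refine huL (mem_directionSpace.2 ?_)
    rintro q (hq | hq)
    · exact hu.1 q hq
    · have h₁ := hw q (Or.inr hq)
      simp only [map_add, map_smul, smul_eq_mul] at h₁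
      have h₂ := mul_nonneg ht.le (hv.2 q hq)
      linarith [hu.2 q hq]
  generalize directionSpace (E ∪ P) = D at *
  by_cases h₀ : (openPolyhedron (insert p E) P).Nonempty
  · obtain ⟨h₁, h₂⟩ := hN₀ h₀
    have h := hN.2 (Or.inl h₀)
    rw [ite_and_of_left h, ite_and_of_left h₀, ite_and_of_left h₁, ite_and_of_left h₂]
    refine ite_neg_add_ite_neg _
      ⟨fun k => ⟨fun v hv => k v hv.1, fun v hv => k v hv.1⟩, fun k v hv => ?_⟩
      ⟨hG, fun k v hv => k.elim (fun k => k v ⟨hv.1, hv.2.ge⟩) (fun k => k v ⟨hv.1, hv.2.le⟩)⟩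
    exact (le_total 0 (p.1 v)).elim (fun h => k.1 v ⟨hv, h⟩) (fun h => k.2 v ⟨hv, h⟩)
  · by_cases h₁ : (openPolyhedron E (insert p P)).Nonempty
    · have h₂ : ¬ (openPolyhedron E (insert (-p) P)).Nonempty := fun h₂ => h₀ (hNN h₁ h₂)
      have h := hN.2 (Or.inr (Or.inl h₁))
      have hC : (∀ v, v ∈ recessionCone E P ∧ 0 ≤ p.1 v → v ∈ D) ↔
          ∀ v ∈ recessionCone E P, v ∈ D :=
        forall_congr' fun v => by rw [and_iff_left_of_imp (hR₁ h₁ h₀ v)]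
      rw [ite_and_of_left h, ite_and_of_not_left h₀, ite_and_of_left h₁, ite_and_of_not_left h₂,
        sub_zero, add_zero]
      exact if_congr hC rfl rfl
    · by_cases h₂ : (openPolyhedron E (insert (-p) P)).Nonempty
      · have h := hN.2 (Or.inr (Or.inr h₂))
        have hC : (∀ v, v ∈ recessionCone E P ∧ p.1 v ≤ 0 → v ∈ D) ↔
            ∀ v ∈ recessionCone E P, v ∈ D :=
          forall_congr' fun v => by rw [and_iff_left_of_imp (hR₂ h₂ h₀ v)]
        rw [ite_and_of_left h, ite_and_of_not_left h₀, ite_and_of_not_left h₁, ite_and_of_left h₂,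
          sub_zero, zero_add]
        exact if_congr hC rfl rfl
      · have h : ¬ (openPolyhedron E P).Nonempty := by tauto
        rw [ite_and_of_not_left h, ite_and_of_not_left h₀, ite_and_of_not_left h₁,
          ite_and_of_not_left h₂]
        rfl

/-- Cutting a relatively open polyhedron by a hyperplane: additivity of the valuation. -/
theorem polyhedronEuler_insert_add [FiniteDimensional ℝ V] (hP : P.Finite) :
    polyhedronEuler E (insert p P) + polyhedronEuler E (insert (-p) P) =
      polyhedronEuler E P - polyhedronEuler (insert p E) P := by
  by_cases hW : ∃ w ∈ directionSpace E, p.1 w ≠ 0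
  · by_cases hL : ∃ u ∈ directionSpace (E ∪ P), p.1 u ≠ 0
    · exact polyhedronEuler_of_exists_mem_lineality hL
    · push Not at hL
      exact polyhedronEuler_of_lineality_le hP hL hW
  · push Not at hW
    exact polyhedronEuler_of_ker_eq hW

/-- Summing the valuation over all open cells of an arrangement inside a polyhedron equals an
alternating sum over subarrangements. -/
theorem sum_polyhedronEuler [FiniteDimensional ℝ V] {ι : Type*} [DecidableEq ι]
    (f : ι → Module.Dual ℝ V × ℝ) (S : Finset ι) (E : Set (Module.Dual ℝ V × ℝ)) :
    ∑ T ∈ S.powerset, polyhedronEuler E (f '' T ∪ (-f) '' ↑(S \ T)) =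
      ∑ B ∈ S.powerset, (-1) ^ B.card * polyhedronEuler (f '' B ∪ E) ∅ := by
  induction S using Finset.induction_on generalizing E with
  | empty => simp
  | insert i S hi ih =>
    rw [Finset.sum_powerset_insert hi, Finset.sum_powerset_insert hi, ← Finset.sum_add_distrib]
    have h : ∀ T ∈ S.powerset,
        polyhedronEuler E (f '' T ∪ (-f) '' ↑(insert i S \ T)) +
          polyhedronEuler E (f '' ↑(insert i T) ∪ (-f) '' ↑(insert i S \ insert i T)) =
        polyhedronEuler E (f '' T ∪ (-f) '' ↑(S \ T)) -
          polyhedronEuler (insert (f i) E) (f '' T ∪ (-f) '' ↑(S \ T)) := by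
      intro T hT
      have hiT : i ∉ T := fun h => hi (Finset.mem_powerset.1 hT h)
      rw [← polyhedronEuler_insert_add
        ((T.finite_toSet.image _).union ((S \ T).finite_toSet.image _)), add_comm]
      congr 2
      · rw [Finset.insert_sdiff_insert, Finset.sdiff_insert_of_notMem hi, Finset.coe_insert,
          Set.image_insert_eq, Set.insert_union]
      · rw [Finset.insert_sdiff_of_notMem _ hiT, Finset.coe_insert, Set.image_insert_eq,
          Set.union_insert, Pi.neg_apply]
    rw [Finset.sum_congr rfl h, Finset.sum_sub_distrib, ih, ih, sub_eq_add_neg,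
      ← Finset.sum_neg_distrib]
    congr 1
    refine Finset.sum_congr rfl fun B hB => ?_
    have hiB : i ∉ B := fun h => hi (Finset.mem_powerset.1 hB h)
    rw [Finset.card_insert_of_notMem hiB, Finset.coe_insert, Set.image_insert_eq,
      Set.insert_union, Set.union_insert]
    ring

end Polyhedra

section Cells

variable {V : Type*} [NormedAddCommGroup V] [NormedSpace ℝ V]

theorem eq_zero_of_mem_recessionCone {E P : Set (Module.Dual ℝ V × ℝ)}
    (hne : (openPolyhedron E P).Nonempty) (hb : Bornology.IsBounded (openPolyhedron E P))
    {v : V} (hv : v ∈ recessionCone E P) : v = 0 := by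
  obtain ⟨x, hx⟩ := hne
  obtain ⟨M, hM⟩ := hb.exists_norm_le
  by_contra hv0
  have hv0' : 0 < ‖v‖ := norm_pos_iff.2 hv0
  have hM0 : 0 ≤ M := (norm_nonneg x).trans (hM x hx)
  have ht : 0 ≤ (M + ‖x‖ + 1) / ‖v‖ := by positivity
  have h₁ := hM _ (add_smul_mem_openPolyhedron hx hv ht)
  have h₂ := norm_sub_le (x + ((M + ‖x‖ + 1) / ‖v‖) • v) x
  rw [add_sub_cancel_left, norm_smul, Real.norm_of_nonneg ht, div_mul_cancel₀ _ hv0'.ne'] at h₂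
  linarith

theorem isBounded_openPolyhedron [FiniteDimensional ℝ V] {E P : Set (Module.Dual ℝ V × ℝ)}
    (h : ∀ v ∈ recessionCone E P, v = 0) : Bornology.IsBounded (openPolyhedron E P) := by
  by_contra hb
  have hseq : ∀ k : ℕ, ∃ x ∈ openPolyhedron E P, (k + 1 : ℝ) ≤ ‖x‖ := by
    intro k
    by_contra! hk
    exact hb (isBounded_iff_forall_norm_le.2 ⟨k + 1, fun x hx => (hk x hx).le⟩)
  choose x hx hxk using hseq
  have hpos : ∀ k, 0 < ‖x k‖ := fun k => (by positivity : (0 : ℝ) < k + 1).trans_le (hxk k)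
  have hinv : Filter.Tendsto (fun k => ‖x k‖⁻¹) Filter.atTop (nhds 0) :=
    (Filter.tendsto_atTop_mono hxk
      (Filter.tendsto_atTop_add_const_right _ _ tendsto_natCast_atTop_atTop)).inv_tendsto_atTop
  obtain ⟨v, hv, φ, hφ, hlim⟩ := (isCompact_sphere (0 : V) 1).tendsto_subseq
    (x := fun k => ‖x k‖⁻¹ • x k) fun k => by
      rw [mem_sphere_zero_iff_norm, norm_smul, norm_inv, norm_norm, inv_mul_cancel₀ (hpos k).ne']
  have key : ∀ p : Module.Dual ℝ V × ℝ, Filter.Tendsto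
      (fun k => ‖x (φ k)‖⁻¹ * (p.1 (x (φ k)) + p.2)) Filter.atTop (nhds (p.1 v)) := by
    intro p
    have h₁ := (p.1.continuous_of_finiteDimensional.tendsto v).comp hlim
    have h₂ := (hinv.comp hφ.tendsto_atTop).mul_const p.2
    have h₃ := h₁.add h₂
    rw [zero_mul, add_zero] at h₃
    refine h₃.congr fun k => ?_
    simp only [Function.comp_apply, map_smul, smul_eq_mul]
    ring
  have hv0 : v = 0 := by
    refine h v ⟨fun p hp => ?_, fun p hp => ?_⟩
    · refine tendsto_nhds_unique (key p) ?_
      simp [(hx _).1 p hp]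
    · exact ge_of_tendsto' (key p) fun k =>
        mul_nonneg (inv_nonneg.2 (norm_nonneg _)) ((hx _).2 p hp).le
  simp [hv0] at hv

variable {ι : Type*} [DecidableEq ι] {f : ι → Module.Dual ℝ V × ℝ} {S T : Finset ι} {x : V}

/-- The open cell of the arrangement `(f i = 0)`, `i ∈ S`, on which exactly the functions with
index in `T` are positive. -/
def arrangementCell (f : ι → Module.Dual ℝ V × ℝ) (S T : Finset ι) : Set V :=
  openPolyhedron ∅ (f '' T ∪ (-f) '' ↑(S \ T))

theorem mem_arrangementCell (hT : T ⊆ S) : x ∈ arrangementCell f S T ↔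
    ∀ i ∈ S, (i ∈ T → 0 < (f i).1 x + (f i).2) ∧ (i ∉ T → (f i).1 x + (f i).2 < 0) := by
  have h : ∀ i, (0 < (-f i).1 x + (-f i).2) ↔ (f i).1 x + (f i).2 < 0 := by
    intro i
    simp only [Prod.fst_neg, Prod.snd_neg, LinearMap.neg_apply]
    constructor <;> intro h <;> linarith
  simp only [arrangementCell, openPolyhedron, Set.mem_ofPred_eq, Set.mem_empty_iff_false,
    false_imp_iff, implies_true, true_and, Set.mem_union, or_imp, forall_and,
    Set.forall_mem_image, Finset.mem_coe, Finset.mem_sdiff, and_imp, Pi.neg_apply, h]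
  exact and_congr_left fun _ => ⟨fun h i _ hi => h hi, fun h i hi => h i (hT hi) hi⟩

theorem sum_neg_one_pow_card_eq_card_isBounded [FiniteDimensional ℝ V]
    (f : ι → Module.Dual ℝ V × ℝ) (S : Finset ι) (hf : ∀ v, (∀ i ∈ S, (f i).1 v = 0) → v = 0)
    [DecidablePred fun T => (arrangementCell f S T).Nonempty ∧
      Bornology.IsBounded (arrangementCell f S T)]
    [DecidablePred fun B : Finset ι => (openPolyhedron (f '' (B : Set ι)) ∅).Nonempty] :
    ∑ B ∈ S.powerset.filter fun B : Finset ι => (openPolyhedron (f '' (B : Set ι)) ∅).Nonempty,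
        (-1 : ℤ) ^ B.card =
      (-1) ^ Module.finrank ℝ V * (S.powerset.filter fun T => (arrangementCell f S T).Nonempty ∧
        Bornology.IsBounded (arrangementCell f S T)).card := by
  have h := sum_polyhedronEuler f S ∅
  have hcell : ∀ T ∈ S.powerset, polyhedronEuler ∅ (f '' T ∪ (-f) '' ↑(S \ T)) =
      if (arrangementCell f S T).Nonempty ∧ Bornology.IsBounded (arrangementCell f S T) then
        (-1) ^ Module.finrank ℝ V else 0 := by
    intro T hT
    have hL : directionSpace (∅ ∪ (f '' T ∪ (-f) '' ↑(S \ T))) = ⊥ := by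
      refine (Submodule.eq_bot_iff _).2 fun v hv => hf v fun i hi => ?_
      rw [mem_directionSpace] at hv
      by_cases hiT : i ∈ T
      · exact hv _ (Or.inr (Or.inl ⟨i, hiT, rfl⟩))
      · have := hv _ (Or.inr (Or.inr ⟨i, by simp [hi, hiT], rfl⟩))
        simpa using this
    have hW : directionSpace (∅ : Set (Module.Dual ℝ V × ℝ)) = ⊤ := by simp [directionSpace]
    have hQ : (openPolyhedron ∅ (f '' T ∪ (-f) '' ↑(S \ T))).Nonempty ∧
        (∀ v ∈ recessionCone ∅ (f '' T ∪ (-f) '' ↑(S \ T)),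
          v ∈ directionSpace (∅ ∪ (f '' T ∪ (-f) '' ↑(S \ T)))) ↔
        (arrangementCell f S T).Nonempty ∧ Bornology.IsBounded (arrangementCell f S T) := by
      simp only [hL, Submodule.mem_bot]
      exact and_congr_right fun hne =>
        ⟨isBounded_openPolyhedron, fun hb v hv => eq_zero_of_mem_recessionCone hne hb hv⟩
    rw [polyhedronEuler_eq_ite hQ hW hL, finrank_top, finrank_bot, add_zero]
  have hflat : ∀ B ∈ S.powerset, (-1) ^ B.card * polyhedronEuler (f '' (B : Set ι) ∪ ∅) ∅ =
      if (openPolyhedron (f '' (B : Set ι)) ∅).Nonempty then (-1) ^ B.card else 0 := by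
    intro B _
    have hQ : (openPolyhedron (f '' (B : Set ι)) ∅).Nonempty ∧
        (∀ v ∈ recessionCone (f '' (B : Set ι)) ∅, v ∈ directionSpace (f '' (B : Set ι) ∪ ∅)) ↔
        (openPolyhedron (f '' (B : Set ι)) ∅).Nonempty := by
      rw [Set.union_empty]
      exact and_iff_left fun v hv => mem_directionSpace_of_mem_recessionCone hv
    rw [Set.union_empty, polyhedronEuler_eq_ite hQ rfl (congrArg _ (Set.union_empty _)),
      Even.neg_one_pow ⟨_, rfl⟩, mul_ite, mul_one, mul_zero]
  rw [Finset.sum_congr rfl hcell, Finset.sum_congr rfl hflat, ← Finset.sum_filter,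
    ← Finset.sum_filter, Finset.sum_const, nsmul_eq_mul, mul_comm] at h
  exact h.symm

theorem arrangementCell_subset_compl (hT : T ⊆ S) :
    arrangementCell f S T ⊆ {x | ∀ i ∈ S, (f i).1 x + (f i).2 ≠ 0} := by
  intro x hx i hi
  have h := (mem_arrangementCell hT).1 hx i hi
  by_cases hiT : i ∈ T
  · exact (h.1 hiT).ne'
  · exact (h.2 hiT).ne

theorem connectedComponentIn_eq_arrangementCell [FiniteDimensional ℝ V] (hT : T ⊆ S)
    (hx : x ∈ arrangementCell f S T) :
    connectedComponentIn {x | ∀ i ∈ S, (f i).1 x + (f i).2 ≠ 0} x = arrangementCell f S T := by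
  refine subset_antisymm (fun y hy => (mem_arrangementCell hT).2 fun i hi => ?_)
    (convex_openPolyhedron.isPreconnected.subset_connectedComponentIn hx
      (arrangementCell_subset_compl hT))
  have hc : Continuous fun z => (f i).1 z + (f i).2 :=
    (f i).1.continuous_of_finiteDimensional.add continuous_const
  have hxC := mem_connectedComponentIn (arrangementCell_subset_compl hT hx)
  have hiv : ∀ a b, a ∈ connectedComponentIn {x | ∀ i ∈ S, (f i).1 x + (f i).2 ≠ 0} x →
      b ∈ connectedComponentIn {x | ∀ i ∈ S, (f i).1 x + (f i).2 ≠ 0} x →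
      (f i).1 a + (f i).2 ≤ 0 → 0 ≤ (f i).1 b + (f i).2 → False := by
    intro a b ha hb ha0 hb0
    obtain ⟨z, hz, hz0⟩ := isPreconnected_connectedComponentIn.intermediate_value ha hb
      hc.continuousOn ⟨ha0, hb0⟩
    exact connectedComponentIn_subset _ _ hz i hi hz0
  have h := (mem_arrangementCell hT).1 hx i hi
  refine ⟨fun hiT => ?_, fun hiT => ?_⟩
  · by_contra! hy0
    exact hiv y x hy hxC hy0 (h.1 hiT).le
  · by_contra! hy0
    exact hiv x y hxC hy (h.2 hiT).le hy0

theorem exists_mem_arrangementCell (hx : ∀ i ∈ S, (f i).1 x + (f i).2 ≠ 0) :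
    ∃ T ⊆ S, x ∈ arrangementCell f S T := by
  classical
  refine ⟨S.filter fun i => 0 < (f i).1 x + (f i).2, Finset.filter_subset _ _,
    (mem_arrangementCell (Finset.filter_subset _ _)).2 fun i hi => ⟨fun h => ?_, fun h => ?_⟩⟩
  · exact (Finset.mem_filter.1 h).2
  · exact (hx i hi).lt_of_le (not_lt.1 fun h' => h (Finset.mem_filter.2 ⟨hi, h'⟩))

theorem card_bounded_components [FiniteDimensional ℝ V] (f : ι → Module.Dual ℝ V × ℝ)
    (S : Finset ι) [DecidablePred fun T => (arrangementCell f S T).Nonempty ∧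
      Bornology.IsBounded (arrangementCell f S T)] :
    Nat.card {C : Set V | (∃ x ∈ {x | ∀ i ∈ S, (f i).1 x + (f i).2 ≠ 0},
        C = connectedComponentIn {x | ∀ i ∈ S, (f i).1 x + (f i).2 ≠ 0} x) ∧
        Bornology.IsBounded C} =
      (S.powerset.filter fun T => (arrangementCell f S T).Nonempty ∧
        Bornology.IsBounded (arrangementCell f S T)).card := by
  have himg : {C : Set V | (∃ x ∈ {x | ∀ i ∈ S, (f i).1 x + (f i).2 ≠ 0},
        C = connectedComponentIn {x | ∀ i ∈ S, (f i).1 x + (f i).2 ≠ 0} x) ∧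
        Bornology.IsBounded C} =
      arrangementCell f S '' ↑(S.powerset.filter fun T => (arrangementCell f S T).Nonempty ∧
        Bornology.IsBounded (arrangementCell f S T)) := by
    ext C
    constructor
    · rintro ⟨⟨x, hx, rfl⟩, hb⟩
      obtain ⟨T, hT, hxT⟩ := exists_mem_arrangementCell hx
      have hC := connectedComponentIn_eq_arrangementCell hT hxT
      rw [hC] at hb ⊢
      exact ⟨T, by simpa using ⟨hT, ⟨x, hxT⟩, hb⟩, rfl⟩
    · rintro ⟨T, hT, rfl⟩
      obtain ⟨hT, ⟨x, hx⟩, hb⟩ := Finset.mem_filter.1 (Finset.mem_coe.1 hT)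
      have hT := Finset.mem_powerset.1 hT
      exact ⟨⟨x, arrangementCell_subset_compl hT hx,
        (connectedComponentIn_eq_arrangementCell hT hx).symm⟩, hb⟩
  rw [himg, Nat.card_coe_set_eq, Set.InjOn.ncard_image, Set.ncard_coe_finset]
  intro T hT U hU hTU
  obtain ⟨hT, ⟨x, hx⟩, -⟩ := Finset.mem_filter.1 (Finset.mem_coe.1 hT)
  have hU := Finset.mem_powerset.1 (Finset.mem_filter.1 (Finset.mem_coe.1 hU)).1
  have hT := Finset.mem_powerset.1 hT
  have hxU : x ∈ arrangementCell f S U := hTU ▸ hx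
  ext i
  refine ⟨fun hi => ?_, fun hi => ?_⟩
  · by_contra hiU
    exact lt_asymm (((mem_arrangementCell hT).1 hx i (hT hi)).1 hi)
      (((mem_arrangementCell hU).1 hxU i (hT hi)).2 hiU)
  · by_contra hiT
    exact lt_asymm (((mem_arrangementCell hU).1 hxU i (hU hi)).1 hi)
      (((mem_arrangementCell hT).1 hx i (hU hi)).2 hiT)

end Cells

/-- Every affine hyperplane is the zero set of a nonconstant affine function. -/
theorem IsAffineHyperplane.exists_dual {n : ℕ} {H : Set (Fin n → ℝ)} (hH : IsAffineHyperplane H) :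
    ∃ p : Module.Dual ℝ (Fin n → ℝ) × ℝ, p.1 ≠ 0 ∧ ∀ x, x ∈ H ↔ p.1 x + p.2 = 0 := by
  obtain ⟨a, b, ha, rfl⟩ := hH
  refine ⟨(Fintype.linearCombination ℝ a, -b), fun h => ha ?_, fun x => ?_⟩
  · ext i
    simpa [Fintype.linearCombination_apply, Pi.single_apply] using
      LinearMap.congr_fun h (Pi.single i 1)
  · simp [Fintype.linearCombination_apply, mul_comm, add_neg_eq_zero]

/-- The linear parts of defining functions of an essential arrangement have no common zero. -/
theorem eq_zero_of_essential {n : ℕ} {A : Finset (Set (Fin n → ℝ))}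
    (hess : Submodule.span ℝ
        {a : Fin n → ℝ | ∃ b : ℝ, a ≠ 0 ∧
          ∃ H ∈ A, H = {x : Fin n → ℝ | ∑ i, a i * x i = b}} = ⊤)
    {f : Set (Fin n → ℝ) → Module.Dual ℝ (Fin n → ℝ) × ℝ}
    (hf : ∀ H ∈ A, ∀ x, x ∈ H ↔ (f H).1 x + (f H).2 = 0) {v : Fin n → ℝ}
    (hv : ∀ H ∈ A, (f H).1 v = 0) : v = 0 := by
  have h : ∀ a : Fin n → ℝ, a ⬝ᵥ v = 0 := by
    intro a
    have ha : a ∈ Submodule.span ℝ {a : Fin n → ℝ | ∃ b : ℝ, a ≠ 0 ∧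
          ∃ H ∈ A, H = {x : Fin n → ℝ | ∑ i, a i * x i = b}} := hess ▸ Submodule.mem_top
    induction ha using Submodule.span_induction with
    | zero => simp
    | add x y _ _ hx hy => rw [add_dotProduct, hx, hy, add_zero]
    | smul t x _ hx => rw [smul_dotProduct, hx, smul_zero]
    | mem a ha =>
      obtain ⟨b, ha0, H, hH, hHab⟩ := ha
      have hmem : ∀ x, x ∈ H ↔ a ⬝ᵥ x = b := fun x => by rw [hHab]; rfl
      have haa : a ⬝ᵥ a ≠ 0 := fun h => ha0 (dotProduct_self_eq_zero.1 h)
      have hx : (b / (a ⬝ᵥ a)) • a ∈ H := by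
        rw [hmem, dotProduct_smul, smul_eq_mul, div_mul_cancel₀ _ haa]
      have hxv : (b / (a ⬝ᵥ a)) • a + v ∈ H := by
        rw [hf H hH, map_add, hv H hH, add_zero]
        exact (hf H hH _).1 hx
      rw [hmem] at hx hxv
      rw [dotProduct_add, hx] at hxv
      linarith
  exact dotProduct_self_eq_zero.1 (h v)

open scoped Classical in
/-- **Zaslavsky's theorem, bounded version.** For a finite essential arrangement `A` of
affine hyperplanes in `ℝⁿ` (the normal vectors of the hyperplanes span `ℝⁿ`), the number
of bounded regions of `A` (bounded connected components of the complement of `⋃_{H ∈ A} H`)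
equals `|μ(0̂, 1̂)|`, the Möbius function of `L(A) ∪ {1̂}` evaluated from the minimal element
`0̂ = ℝⁿ` to the adjoined maximal element `1̂`. -/
theorem zaslavsky_bounded_regions (n : ℕ) (A : Finset (Set (Fin n → ℝ)))
    (hA : ∀ H ∈ A, IsAffineHyperplane H)
    (hess : Submodule.span ℝ
        {a : Fin n → ℝ | ∃ b : ℝ, a ≠ 0 ∧
          ∃ H ∈ A, H = {x : Fin n → ℝ | ∑ i, a i * x i = b}} = ⊤) :
    Nat.card {C : Set (Fin n → ℝ) |
        (∃ x ∈ (⋃ H ∈ A, (H : Set (Fin n → ℝ)))ᶜ,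
          C = connectedComponentIn (⋃ H ∈ A, (H : Set (Fin n → ℝ)))ᶜ x) ∧
        Bornology.IsBounded C} =
      (IncidenceAlgebra.mu ℤ
        (↑(IntersectionPoset.bot A) : WithTop (IntersectionPoset A)) ⊤).natAbs := by
  have hdual : ∀ H : Set (Fin n → ℝ), ∃ p : Module.Dual ℝ (Fin n → ℝ) × ℝ,
      H ∈ A → p.1 ≠ 0 ∧ ∀ x, x ∈ H ↔ p.1 x + p.2 = 0 := by
    intro H
    by_cases hH : H ∈ A
    · obtain ⟨p, hp⟩ := (hA H hH).exists_dual
      exact ⟨p, fun _ => hp⟩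
    · exact ⟨0, fun h => absurd h hH⟩
  choose f hf using hdual
  have huniv : ∀ H ∈ A, H ≠ Set.univ := by
    rintro H hH hu
    refine (hf H hH).1 (LinearMap.ext fun v => ?_)
    have h₁ := ((hf H hH).2 v).1 (hu ▸ Set.mem_univ v)
    have h₂ := ((hf H hH).2 0).1 (hu ▸ Set.mem_univ 0)
    rw [map_zero] at h₂
    rw [LinearMap.zero_apply]
    linarith
  have hcompl : (⋃ H ∈ A, (H : Set (Fin n → ℝ)))ᶜ =
      {x | ∀ H ∈ A, (f H).1 x + (f H).2 ≠ 0} := by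
    ext x
    simp only [Set.mem_compl_iff, Set.mem_iUnion, not_exists, Set.mem_ofPred_eq]
    exact forall₂_congr fun H hH => not_congr ((hf H hH).2 x)
  have hflat : ∀ B ∈ A.powerset,
      (⋂ H ∈ B, (H : Set (Fin n → ℝ))) = openPolyhedron (f '' (B : Set _)) ∅ := by
    intro B hB
    ext x
    simp only [Set.mem_iInter, openPolyhedron, Set.mem_ofPred_eq, Set.forall_mem_image,
      Finset.mem_coe, Set.mem_empty_iff_false, false_imp_iff, implies_true, and_true]
    exact forall₂_congr fun H hH => (hf H (Finset.mem_powerset.1 hB hH)).2 x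
  have hfilter : (A.powerset.filter fun B : Finset _ => (⋂ H ∈ B, (H : Set (Fin n → ℝ))).Nonempty) =
      A.powerset.filter fun B : Finset _ => (openPolyhedron (f '' (B : Set _)) ∅).Nonempty :=
    Finset.filter_congr fun B hB => by rw [hflat B hB]
  rw [hcompl, card_bounded_components f A, mu_bot_top A huniv, hfilter,
    sum_neg_one_pow_card_eq_card_isBounded f A fun v hv =>
      eq_zero_of_essential hess (fun H hH => (hf H hH).2) hv]
  simp [Int.natAbs_mul, Int.natAbs_pow]
end

section
/- Let P be a finite poset with elements p₁, …, pₙ, K a field, and R = K[x₁, …, xₙ, y₁, …, yₙ]. Let H_P be the Hibi ideal of P, the ideal of R generated by the squarefree monomials u_I = (∏_{p_i ∈ I} x_i)(∏_{p_i ∉ I} y_i) as I ranges over the order ideals of P. Then the projective dimension of H_P as an R-module equals the Dilworth number of P, i.e., the maximum cardinality of an antichain in P. -/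
open CategoryTheory MvPolynomial

/-- The Hibi ideal of a finite poset `P` over a field `K`: the ideal of
`R = K[xₚ, yₚ : p ∈ P]` generated by the squarefree monomials
`u_I = (∏_{p ∈ I} xₚ) (∏_{p ∉ I} yₚ)`, as `I` ranges over the order ideals
(lower sets) of `P`.  The variable `xₚ` is `X (Sum.inl p)` and `yₚ` is `X (Sum.inr p)`. -/
noncomputable def hibiIdeal (K : Type) [Field K] (P : Type) [Fintype P] [PartialOrder P]
    [DecidableEq P] : Ideal (MvPolynomial (P ⊕ P) K) :=
  Ideal.span {f | ∃ I : Finset P, IsLowerSet (I : Set P) ∧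
    f = (∏ p ∈ I, X (Sum.inl p)) * ∏ p ∈ Iᶜ, X (Sum.inr p)}

section ProjectiveResolutions

universe v u

variable {C : Type u} [Category.{v} C] [Abelian C]

/-- The augmentation `P₀ ⟶ X` of a projective resolution `P` of `X`. -/
noncomputable def CategoryTheory.ProjectiveResolution.augmentation {X : C}
    (Pr : ProjectiveResolution X) : Pr.complex.X 0 ⟶ X :=
  Pr.π.f 0

theorem CategoryTheory.ProjectiveResolution.d_comp_augmentation {X : C}
    (Pr : ProjectiveResolution X) : Pr.complex.d 1 0 ≫ Pr.augmentation = 0 :=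
  Pr.complex_d_comp_π_f_zero

theorem CategoryTheory.ProjectiveResolution.d_comp_augmentation_comp {X Y : C}
    (Pr : ProjectiveResolution X) (f : X ⟶ Y) :
    Pr.complex.d 1 0 ≫ Pr.augmentation ≫ f = 0 := by
  rw [← Category.assoc, Pr.d_comp_augmentation, Limits.zero_comp]

/-- Splicing a projective resolution of the kernel `S.X₁` of an epimorphism `S.X₂ ⟶ S.X₃` from a
projective object gives a projective resolution of `S.X₃`. -/
noncomputable def CategoryTheory.ShortComplex.ShortExact.spliceResolution {S : ShortComplex C}
    (hS : S.ShortExact) [Projective S.X₂] (Pr : ProjectiveResolution S.X₁) :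
    ProjectiveResolution S.X₃ where
  complex := ChainComplex.augment Pr.complex (Pr.augmentation ≫ S.f)
    (Pr.d_comp_augmentation_comp S.f)
  projective n := by
    cases n
    · exact inferInstanceAs (Projective S.X₂)
    · exact Pr.projective _
  π := (ChainComplex.toSingle₀Equiv _ _).symm ⟨S.g,
    show (Pr.augmentation ≫ S.f) ≫ S.g = 0 by simp⟩
  quasiIso := ⟨fun n => by
    have : Mono S.f := hS.mono_f
    have : Epi S.g := hS.epi_g
    cases n with
    | zero =>
      rw [ChainComplex.quasiIsoAt₀_iff, ShortComplex.quasiIso_iff_of_zeros']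
      · refine (ShortComplex.exact_and_epi_g_iff_of_iso
          (S₁ := ShortComplex.mk (Pr.augmentation ≫ S.f) S.g (by simp)) ?_).1 ⟨?_, hS.epi_g⟩
        · exact ShortComplex.isoMk (Iso.refl _) (Iso.refl _) (Iso.refl _)
            ((Category.id_comp _).trans (Category.comp_id _).symm)
            ((Category.id_comp _).trans ((ChainComplex.toSingle₀Equiv_symm_apply_f_zero _ _).trans
              (Category.comp_id S.g).symm))
        · let α : ShortComplex.mk (Pr.augmentation ≫ S.f) S.g (by simp) ⟶ S :=
            { τ₁ := Pr.augmentation, τ₂ := 𝟙 _, τ₃ := 𝟙 _ }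
          have : Epi α.τ₁ := inferInstanceAs (Epi (Pr.π.f 0))
          have : IsIso α.τ₂ := inferInstanceAs (IsIso (𝟙 _))
          have : Mono α.τ₃ := inferInstanceAs (Mono (𝟙 _))
          exact (ShortComplex.exact_iff_of_epi_of_isIso_of_mono α).2 hS.exact
      all_goals rfl
    | succ n =>
      rw [quasiIsoAt_iff_exactAt']
      · rw [HomologicalComplex.exactAt_iff' _ (n + 1 + 1) (n + 1) n (by simp) (by simp)]
        cases n with
        | zero =>
          let α : ShortComplex.mk (Pr.complex.d 1 0) Pr.augmentation Pr.d_comp_augmentation ⟶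
              ShortComplex.mk (Pr.complex.d 1 0) (Pr.augmentation ≫ S.f)
                (Pr.d_comp_augmentation_comp S.f) :=
            { τ₁ := 𝟙 _, τ₂ := 𝟙 _, τ₃ := S.f }
          have : Epi α.τ₁ := inferInstanceAs (Epi (𝟙 _))
          have : IsIso α.τ₂ := inferInstanceAs (IsIso (𝟙 _))
          have : Mono α.τ₃ := inferInstanceAs (Mono S.f)
          exact (ShortComplex.exact_iff_of_epi_of_isIso_of_mono α).1 Pr.exact₀
        | succ n => exact Pr.exact_succ n
      · exact ChainComplex.exactAt_succ_single_obj _ _⟩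

theorem CategoryTheory.HasProjectiveDimensionLE.exists_projectiveResolution [EnoughProjectives C]
    (n : ℕ) (X : C) [HasProjectiveDimensionLE X n] :
    ∃ Pr : ProjectiveResolution X, ∀ k : ℕ, n < k → Limits.IsZero (Pr.complex.X k) := by
  induction n generalizing X with
  | zero =>
    have : Projective X := projective_iff_hasProjectiveDimensionLE_zero X |>.2 inferInstance
    exact ⟨.self X, fun k hk => HomologicalComplex.isZero_single_obj_X _ _ _ _ (by lia)⟩
  | succ n ih =>
    let S := ShortComplex.mk (Limits.kernel.ι (Projective.π X)) (Projective.π X) (by simp)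
    have hS : S.ShortExact :=
      { exact := ShortComplex.exact_kernel _
        mono_f := inferInstanceAs (Mono (Limits.kernel.ι _))
        epi_g := inferInstanceAs (Epi (Projective.π X)) }
    have : Projective S.X₂ := Projective.projective_over X
    have : HasProjectiveDimensionLE S.X₁ n :=
      (hS.hasProjectiveDimensionLT_X₃_iff n this).1 ‹_›
    obtain ⟨Pr, hPr⟩ := ih S.X₁
    refine ⟨hS.spliceResolution Pr, fun k hk => ?_⟩
    obtain ⟨k, rfl⟩ := Nat.exists_eq_add_one_of_ne_zero (by lia : k ≠ 0)
    exact hPr k (by lia)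

theorem CategoryTheory.ProjectiveResolution.hasProjectiveDimensionLE {X : C}
    (Pr : ProjectiveResolution X) {n : ℕ}
    (h : ∀ k : ℕ, n < k → Limits.IsZero (Pr.complex.X k)) : HasProjectiveDimensionLE X n := by
  let := HasExt.standard C
  refine HasProjectiveDimensionLT.mk fun i hi Y e => ?_
  obtain ⟨f, hf, rfl⟩ := Pr.extMk_surjective e _ rfl
  obtain rfl : f = 0 := (h i hi).eq_of_src _ _
  exact Pr.extMk_zero _ rfl

end ProjectiveResolutions

section Modules

open Abelian

variable {R : Type} [CommRing R]

theorem ModuleCat.hasProjectiveDimensionLT_prod (M N : Type) [AddCommGroup M] [Module R M]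
    [AddCommGroup N] [Module R N] (n : ℕ) (hM : HasProjectiveDimensionLT (ModuleCat.of R M) n)
    (hN : HasProjectiveDimensionLT (ModuleCat.of R N) n) :
    HasProjectiveDimensionLT (ModuleCat.of R (M × N)) n :=
  hasProjectiveDimensionLT_of_iso (ModuleCat.biprodIsoProd (.of R M) (.of R N)) n

/-- Adjoining a generator `u` to an ideal `A` raises the projective dimension at most as much as
the colon ideal `A : u` allows. -/
theorem Ideal.hasProjectiveDimensionLT_sup_span_singleton {A Q : Ideal R} {u : R}
    (hQ : ∀ r, r ∈ Q ↔ r * u ∈ A) {n : ℕ}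
    (hA : HasProjectiveDimensionLT (ModuleCat.of R A) (n + 1))
    (hQn : HasProjectiveDimensionLT (ModuleCat.of R Q) n) :
    HasProjectiveDimensionLT (ModuleCat.of R (A ⊔ Ideal.span {u} : Ideal R)) (n + 1) := by
  let f : Q →ₗ[R] A × R :=
    LinearMap.prod
      ((LinearMap.mulRight R u ∘ₗ Q.subtype).codRestrict A fun r => (hQ r).1 r.2)
      (-Q.subtype)
  let g : A × R →ₗ[R] (A ⊔ Ideal.span {u} : Ideal R) :=
    LinearMap.coprod (Submodule.inclusion le_sup_left)
      (LinearMap.toSpanSingleton R _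
        ⟨u, Ideal.mem_sup_right (Ideal.mem_span_singleton_self u)⟩)
  have hg : ∀ x : A × R, (g x : R) = x.1 + x.2 * u := fun x => by simp [g]
  have hf : ∀ x : Q, f x = (⟨x * u, (hQ x).1 x.2⟩, -(x : R)) := fun x => rfl
  have hfg : g.comp f = 0 := by
    ext x
    simp [hg, hf]
  let S := ModuleCat.shortComplexOfCompEqZero f g hfg
  have hS : S.ShortExact := by
    refine ModuleCat.shortComplex_shortExact S ?_ ?_ ?_
    · intro x
      refine ⟨fun hx => ?_, fun ⟨y, hy⟩ => hy ▸ DFunLike.congr_fun hfg y⟩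
      have hx' : (x.1 : R) + x.2 * u = 0 := by
        rw [← hg x]
        exact congrArg Subtype.val hx
      have hmem : -x.2 ∈ Q := (hQ _).2 (by
        rw [neg_mul, ← eq_neg_of_add_eq_zero_left hx']
        exact x.1.2)
      refine ⟨⟨-x.2, hmem⟩, ?_⟩
      refine (hf _).trans (Prod.ext (Subtype.ext ?_) (neg_neg _))
      change -x.2 * u = x.1
      rw [neg_mul, ← eq_neg_of_add_eq_zero_left hx']
    · intro x y hxy
      exact Subtype.ext (neg_injective (congrArg Prod.snd hxy))
    · rintro ⟨x, hx⟩
      obtain ⟨a, ha, b, hb, rfl⟩ := Submodule.mem_sup.1 hx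
      obtain ⟨r, rfl⟩ := Ideal.mem_span_singleton'.1 hb
      exact ⟨(⟨a, ha⟩, r), Subtype.ext (hg _)⟩
  have : Projective (ModuleCat.of R R) := (IsProjective.iff_projective R).1 inferInstance
  exact hS.hasProjectiveDimensionLT_X₃ n hQn
    (ModuleCat.hasProjectiveDimensionLT_prod A R _ hA
      (hasProjectiveDimensionLT_of_ge _ 1 _ (by lia)))

/-- An element of `R` that kills `X` and acts as the identity on `Y` forces `Ext X Y n` to
vanish. -/
theorem ModuleCat.ext_eq_zero_of_smul {X Y : ModuleCat.{0} R} (m : R) (hX : ∀ x : X, m • x = 0)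
    (hY : ∀ y : Y, m • y = y) {n : ℕ} (e : Ext X Y n) : e = 0 := by
  have h₁ : m • e = e := by
    rw [Ext.smul_eq_comp_mk₀, show m • 𝟙 Y = 𝟙 Y by ext y; exact hY y, Ext.comp_mk₀_id]
  have h₂ : m • e = 0 := by
    rw [← Ext.mk₀_id_comp e, ← Ext.smul_comp, ← Ext.mk₀_smul,
      show m • 𝟙 X = 0 by ext x; exact hX x, Ext.mk₀_zero, Ext.zero_comp]
  rw [← h₁, h₂]

theorem ModuleCat.smul_ext_eq_zero {X Y : ModuleCat.{0} R} (m : R) (hY : ∀ y : Y, m • y = 0)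
    {n : ℕ} (e : Ext X Y n) : m • e = 0 := by
  rw [Ext.smul_eq_comp_mk₀, show m • 𝟙 Y = 0 by ext y; exact hY y, Ext.mk₀_zero, Ext.comp_zero]

theorem Ideal.exists_ext_ne_zero_of_le {H J : Ideal R} (hHJ : H ≤ J) {N : ModuleCat.{0} R} (m : R)
    (hm : ∀ x ∈ J, m * x ∈ H) (hN : ∀ y : N, m • y = y) {n : ℕ}
    (h : ∃ e : Ext (ModuleCat.of R J) N n, e ≠ 0) :
    ∃ e : Ext (ModuleCat.of R H) N n, e ≠ 0 := by
  obtain ⟨e, he⟩ := h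
  let f := Submodule.inclusion hHJ
  let S := ModuleCat.shortComplexOfCompEqZero f f.range.mkQ
    f.exact_map_mkQ_range.linearMap_comp_eq_zero
  have hS : S.ShortExact := ModuleCat.shortComplex_shortExact S f.exact_map_mkQ_range
    (Submodule.inclusion_injective hHJ) (Submodule.mkQ_surjective _)
  refine ⟨(Ext.mk₀ S.f).comp e (zero_add n), fun h0 => he ?_⟩
  obtain ⟨e', rfl⟩ := Ext.contravariant_sequence_exact₂ hS N e h0
  have : e' = 0 := by
    refine ModuleCat.ext_eq_zero_of_smul m (fun x => ?_) hN e'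
    obtain ⟨y, rfl⟩ := Submodule.mkQ_surjective _ x
    rw [← map_smul]
    exact (Submodule.Quotient.mk_eq_zero _).2 ⟨⟨m * y, hm _ y.2⟩, rfl⟩
  rw [this, Ext.comp_zero]

/-- If `J' = x J + y J`, where `x, y` are coprime and kill `N`, then a nonzero class in
`Extⁿ(J, N)` yields one in `Extⁿ⁺¹(J', N)`. -/
theorem Ideal.exists_ext_succ_ne_zero {J J' : Ideal R} {x y : R}
    (hxy : ∀ a b, x * a = y * b → y ∣ a) (hy : y ∈ nonZeroDivisors R)
    (hyJ : ∀ c, y * c ∈ J → c ∈ J)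
    (hJ' : ∀ r, r ∈ J' ↔ ∃ a ∈ J, ∃ b ∈ J, x * a + y * b = r)
    {N : ModuleCat.{0} R} (hxN : ∀ z : N, x • z = 0) (hyN : ∀ z : N, y • z = 0) {n : ℕ}
    (h : ∃ e : Ext (ModuleCat.of R J) N n, e ≠ 0) :
    ∃ e : Ext (ModuleCat.of R J') N (n + 1), e ≠ 0 := by
  obtain ⟨e, he⟩ := h
  let f : J →ₗ[R] J × J := y • LinearMap.inl R J J - x • LinearMap.inr R J J
  let g : J × J →ₗ[R] J' :=
    LinearMap.codRestrict J'
      (x • J.subtype ∘ₗ LinearMap.fst R J J + y • J.subtype ∘ₗ LinearMap.snd R J J)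
      fun z => (hJ' _).2 ⟨_, z.1.2, _, z.2.2, by simp⟩
  have hg : ∀ z : J × J, (g z : R) = x * z.1 + y * z.2 := fun z => by simp [g]
  have hf : ∀ z : J, f z = (y • z, -(x • z)) := fun z => by simp [f]
  have hfg : g.comp f = 0 := by
    ext z
    simp [hg, hf]
    ring
  let S := ModuleCat.shortComplexOfCompEqZero f g hfg
  have hS : S.ShortExact := by
    refine ModuleCat.shortComplex_shortExact S ?_ ?_ ?_
    · rintro ⟨⟨a, ha⟩, ⟨b, hb⟩⟩
      refine ⟨fun hz => ?_, fun ⟨y, hy⟩ => hy ▸ DFunLike.congr_fun hfg y⟩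
      have hz' : x * a + y * b = 0 := by
        rw [← hg (⟨a, ha⟩, ⟨b, hb⟩)]
        exact congrArg Subtype.val hz
      obtain ⟨c, rfl⟩ := hxy a (-b) (by linear_combination hz')
      refine ⟨⟨c, hyJ c ha⟩, (hf _).trans (Prod.ext (Subtype.ext rfl) (Subtype.ext ?_))⟩
      change -(x * c) = b
      refine ((mul_cancel_left_mem_nonZeroDivisors hy).1 ?_)
      linear_combination -hz'
    · intro a b hab
      have h1 : y * (a : R) = y * b := by
        have := congrArg (fun z : J × J => (z.1 : R)) ((hf a).symm.trans (hab.trans (hf b)))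
        exact this
      exact Subtype.ext ((mul_cancel_left_mem_nonZeroDivisors hy).1 h1)
    · rintro ⟨r, hr⟩
      obtain ⟨a, ha, b, hb, rfl⟩ := (hJ' r).1 hr
      exact ⟨(⟨a, ha⟩, ⟨b, hb⟩), Subtype.ext (hg _)⟩
  refine ⟨hS.extClass.comp e (add_comm 1 n), fun h0 => he ?_⟩
  obtain ⟨e', rfl⟩ := Ext.contravariant_sequence_exact₁ hS N e (add_comm 1 n) h0
  have hSf : S.f = y • ModuleCat.ofHom (LinearMap.inl R J J) -
      x • ModuleCat.ofHom (LinearMap.inr R J J) := rfl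
  rw [hSf, sub_eq_add_neg, ← neg_smul, Ext.mk₀_add, Ext.add_comp, Ext.mk₀_smul, Ext.mk₀_smul,
    Ext.smul_comp, Ext.smul_comp, ModuleCat.smul_ext_eq_zero _ hyN,
    ModuleCat.smul_ext_eq_zero _ fun z => by rw [neg_smul, hxN, neg_zero], add_zero]

end Modules

section Variables

variable {σ : Type*} {K : Type*} [CommSemiring K]

theorem MvPolynomial.mem_span_X_image_of_mul_X {s : Set σ} {j : σ} (hj : j ∉ s)
    {f : MvPolynomial σ K} (hf : f * X j ∈ Ideal.span (X '' s : Set (MvPolynomial σ K))) :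
    f ∈ Ideal.span (X '' s : Set (MvPolynomial σ K)) := by
  rw [mem_ideal_span_X_image] at hf ⊢
  intro m hm
  obtain ⟨i, hi, hmi⟩ := hf (m + Finsupp.single j 1) (by
    rwa [mem_support_iff, coeff_mul_X, ← mem_support_iff])
  refine ⟨i, hi, ?_⟩
  rwa [Finsupp.add_apply, Finsupp.single_eq_of_ne (by rintro rfl; exact hj hi),
    add_zero] at hmi

theorem MvPolynomial.mem_span_X_image_of_mul_prod_X {ι : Type*} {s : Set σ} (t : Finset ι)
    {v : ι → σ} (hv : ∀ i ∈ t, v i ∉ s) {f : MvPolynomial σ K}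
    (hf : f * ∏ i ∈ t, X (v i) ∈ Ideal.span (X '' s : Set (MvPolynomial σ K))) :
    f ∈ Ideal.span (X '' s : Set (MvPolynomial σ K)) := by
  classical
  induction t using Finset.induction_on generalizing f with
  | empty => simpa using hf
  | insert i t hi ih =>
    rw [Finset.prod_insert hi, ← mul_assoc] at hf
    exact mem_span_X_image_of_mul_X (hv i (Finset.mem_insert_self i t))
      (ih (fun j hj => hv j (Finset.mem_insert_of_mem hj)) hf)

end Variables

theorem MvPolynomial.hasProjectiveDimensionLT_span_X_image {σ K : Type} [Field K]
    (s : Finset σ) :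
    HasProjectiveDimensionLT (ModuleCat.of (MvPolynomial σ K)
      (Ideal.span (X '' (s : Set σ) : Set (MvPolynomial σ K)))) s.card := by
  classical
  induction s using Finset.induction_on with
  | empty =>
    rw [Finset.coe_empty, Set.image_empty, Ideal.span_empty, Finset.card_empty]
    exact (ModuleCat.isZero_of_subsingleton _).hasProjectiveDimensionLT_zero
  | insert j s hj ih =>
    have h := Ideal.hasProjectiveDimensionLT_sup_span_singleton
      (u := (X j : MvPolynomial σ K)) (fun r =>
        ⟨fun hr => Ideal.mul_mem_right _ _ hr,
          mem_span_X_image_of_mul_X (by simpa using hj)⟩)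
      (hasProjectiveDimensionLT_of_ge _ _ _ (Nat.le_succ s.card)) ih
    rw [Finset.card_insert_of_notMem hj, Finset.coe_insert, Set.image_insert_eq,
      Ideal.span_insert, sup_comm]
    exact h

section Hibi

variable (K : Type) [Field K] {P : Type} [Fintype P] [DecidableEq P]

/-- The monomial `u_I = (∏_{p ∈ I} xₚ) (∏_{p ∉ I} yₚ)`. -/
noncomputable def hibiMonomial (I : Finset P) : MvPolynomial (P ⊕ P) K :=
  (∏ p ∈ I, X (Sum.inl p)) * ∏ p ∈ Iᶜ, X (Sum.inr p)

theorem X_inr_mul_hibiMonomial {I : Finset P} {p : P} (hp : p ∈ I) :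
    X (Sum.inr p) * hibiMonomial K I = X (Sum.inl p) * hibiMonomial K (I.erase p) := by
  rw [hibiMonomial, hibiMonomial, Finset.compl_erase, Finset.prod_insert (by simpa using hp),
    ← Finset.mul_prod_erase I _ hp]
  ring

variable [PartialOrder P]

theorem hibiIdeal_eq_span_image :
    hibiIdeal K P =
      Ideal.span (hibiMonomial K '' {I : Finset P | IsLowerSet (I : Set P)}) := by
  refine congrArg Ideal.span (Set.ext fun f => ?_)
  exact ⟨fun ⟨I, hI, h⟩ => ⟨I, hI, h.symm⟩, fun ⟨I, hI, h⟩ => ⟨I, hI, h.symm⟩⟩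

/-- For a collection `F` of lower sets not containing `I` but all its lower subsets of the form
`I \ {p}`, the colon ideal of `(u_J : J ∈ F)` by `u_I` is generated by the variables `yₚ` with `p`
maximal in `I`. -/
theorem mem_span_X_inr_maximal_iff {F : Set (Finset P)} {I : Finset P}
    (hF : ∀ J ∈ F, IsLowerSet (J : Set P) ∧ ¬ I ⊆ J)
    (hI : ∀ p, Maximal (· ∈ I) p → I.erase p ∈ F) (r : MvPolynomial (P ⊕ P) K) :
    r ∈ Ideal.span (X '' (Sum.inr '' {p | Maximal (· ∈ I) p}) : Set (MvPolynomial (P ⊕ P) K)) ↔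
      r * hibiMonomial K I ∈ Ideal.span (hibiMonomial K '' F) := by
  constructor
  · intro hr
    suffices h : Ideal.span (X '' (Sum.inr '' {p | Maximal (· ∈ I) p})) ≤
        Submodule.comap (LinearMap.mulRight (MvPolynomial (P ⊕ P) K) (hibiMonomial K I))
          (Ideal.span (hibiMonomial K '' F)) from h hr
    rw [Ideal.span_le]
    rintro _ ⟨_, ⟨p, hp, rfl⟩, rfl⟩
    change X (Sum.inr p) * hibiMonomial K I ∈ Ideal.span (hibiMonomial K '' F)
    rw [X_inr_mul_hibiMonomial K hp.prop]
    exact Ideal.mul_mem_left _ _ (Ideal.subset_span ⟨_, hI p hp, rfl⟩)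
  · intro hr
    have hle : Ideal.span (hibiMonomial K '' F) ≤
        Ideal.span (X '' (Sum.inr '' {p | Maximal (· ∈ I) p})) := by
      rw [Ideal.span_le]
      rintro _ ⟨J, hJ, rfl⟩
      obtain ⟨hJl, hIJ⟩ := hF J hJ
      obtain ⟨q, hqI, hqJ⟩ := Finset.not_subset.1 hIJ
      obtain ⟨p, hqp, hp⟩ := I.exists_le_maximal hqI
      have hpJ : p ∈ Jᶜ := Finset.mem_compl.2 fun h => hqJ (hJl hqp h)
      refine Ideal.mem_of_dvd _ ?_ (Ideal.subset_span ⟨_, ⟨p, hp, rfl⟩, rfl⟩)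
      exact (Finset.dvd_prod_of_mem _ hpJ).mul_left _
    have hr' := hle hr
    rw [hibiMonomial, ← mul_assoc] at hr'
    refine mem_span_X_image_of_mul_prod_X I (v := Sum.inl) (by simp)
      (mem_span_X_image_of_mul_prod_X Iᶜ (v := Sum.inr) ?_ hr')
    rintro p hp ⟨q, hq, hqp⟩
    obtain rfl := Sum.inr_injective hqp
    exact Finset.mem_compl.1 hp hq.prop

theorem hasProjectiveDimensionLE_span_hibiMonomial {d : ℕ}
    (hd : ∀ S : Finset P, IsAntichain (· ≤ ·) (S : Set P) → S.card ≤ d) (F : Finset (Finset P))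
    (hF : ∀ I ∈ F, IsLowerSet (I : Set P))
    (hF' : ∀ I ∈ F, ∀ J : Finset P, IsLowerSet (J : Set P) → J ⊆ I → J ∈ F) :
    HasProjectiveDimensionLE (ModuleCat.of (MvPolynomial (P ⊕ P) K)
      (Ideal.span (hibiMonomial K '' (F : Set (Finset P))))) d := by
  classical
  induction F using Finset.strongInduction with
  | H F ih =>
  obtain rfl | hne := F.eq_empty_or_nonempty
  · rw [Finset.coe_empty, Set.image_empty, Ideal.span_empty]
    have := (ModuleCat.isZero_of_subsingleton (ModuleCat.of (MvPolynomial (P ⊕ P) K)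
      (⊥ : Ideal (MvPolynomial (P ⊕ P) K)))).hasProjectiveDimensionLT_zero
    exact hasProjectiveDimensionLT_of_ge _ 0 _ (Nat.zero_le _)
  · obtain ⟨I, hI⟩ := F.exists_maximal hne
    have hIF := hI.prop
    let M : Finset P := {p | Maximal (· ∈ I) p}
    have hM : ((M.map Function.Embedding.inr : Finset (P ⊕ P)) : Set (P ⊕ P)) =
        Sum.inr '' {p | Maximal (· ∈ I) p} := by
      simp [M]
    have hMd : M.card ≤ d := hd M fun a ha b hb hab hle =>
      hab (le_antisymm hle ((Finset.mem_filter.1 ha).2.2 (Finset.mem_filter.1 hb).2.1 hle))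
    have hQ := hasProjectiveDimensionLT_span_X_image (K := K)
      (M.map (Function.Embedding.inr : P ↪ P ⊕ P))
    rw [hM, Finset.card_map] at hQ
    have hcolon : ∀ r, r ∈ Ideal.span (X '' (Sum.inr '' {p | Maximal (· ∈ I) p})) ↔
        r * hibiMonomial K I ∈
          Ideal.span (hibiMonomial K '' ((F.erase I : Finset (Finset P)) : Set (Finset P))) := by
      refine mem_span_X_inr_maximal_iff K ?_ ?_
      · intro J hJ
        obtain ⟨hJI, hJF⟩ := Finset.mem_erase.1 hJ
        exact ⟨hF J hJF, fun hIJ => hJI (hI.eq_of_ge hJF hIJ)⟩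
      intro p hp
      refine Finset.mem_erase.2 ⟨fun h => Finset.erase_eq_self.1 h hp.prop,
        hF' I hIF _ ?_ (Finset.erase_subset p I)⟩
      intro a b hba ha
      obtain ⟨hap, haI⟩ := Finset.mem_erase.1 ha
      refine Finset.mem_erase.2 ⟨?_, hF I hIF hba haI⟩
      rintro rfl
      exact hap (hp.eq_of_ge haI hba)
    have hA := ih (F.erase I) (Finset.erase_ssubset hIF)
      (fun J hJ => hF J (Finset.mem_of_mem_erase hJ)) <| by
      intro J hJ J' hJ' hJJ'
      obtain ⟨hJI, hJF⟩ := Finset.mem_erase.1 hJ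
      refine Finset.mem_erase.2 ⟨?_, hF' J hJF J' hJ' hJJ'⟩
      rintro rfl
      exact hJI (hI.eq_of_ge hJF hJJ')
    have h := Ideal.hasProjectiveDimensionLT_sup_span_singleton hcolon hA
      (hasProjectiveDimensionLT_of_ge _ _ _ hMd)
    rw [← Finset.insert_erase hIF, Finset.coe_insert, Set.image_insert_eq,
      Ideal.span_insert, sup_comm]
    exact h

theorem hasProjectiveDimensionLE_hibiIdeal {d : ℕ}
    (hd : ∀ S : Finset P, IsAntichain (· ≤ ·) (S : Set P) → S.card ≤ d) :
    HasProjectiveDimensionLE (ModuleCat.of (MvPolynomial (P ⊕ P) K) (hibiIdeal K P)) d := by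
  classical
  have h := hasProjectiveDimensionLE_span_hibiMonomial K hd
    ({I | IsLowerSet (I : Set P)} : Finset (Finset P))
    (fun I hI => (Finset.mem_filter.1 hI).2)
    (fun I _ J hJ _ => Finset.mem_filter.2 ⟨Finset.mem_univ J, hJ⟩)
  rwa [Finset.coe_filter_univ, ← hibiIdeal_eq_span_image] at h

end Hibi

section LowerBound

open Abelian

variable (K : Type) [Field K] {P : Type}

/-- The ideal `⋂_{p ∈ S} (xₚ, yₚ)`. -/
noncomputable def pairIdeal (S : Finset P) : Ideal (MvPolynomial (P ⊕ P) K) :=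
  ⨅ p ∈ S, Ideal.span (X '' {Sum.inl p, Sum.inr p})

variable {K}

theorem mem_pairIdeal_iff {S : Finset P} {f : MvPolynomial (P ⊕ P) K} :
    f ∈ pairIdeal K S ↔
      ∀ m ∈ f.support, ∀ p ∈ S, m (Sum.inl p) ≠ 0 ∨ m (Sum.inr p) ≠ 0 := by
  simp only [pairIdeal, Submodule.mem_iInf, mem_ideal_span_X_image, Set.mem_insert_iff,
    Set.mem_singleton_iff, exists_eq_or_imp, exists_eq_left]
  exact ⟨fun h m hm p hp => h p hp m hm, fun h p hp m hm => h m hm p hp⟩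

theorem mem_pairIdeal_of_X_mul_mem {S : Finset P} {j : P ⊕ P}
    (hj : ∀ p ∈ S, j ≠ Sum.inl p ∧ j ≠ Sum.inr p) {f : MvPolynomial (P ⊕ P) K}
    (hf : X j * f ∈ pairIdeal K S) : f ∈ pairIdeal K S := by
  simp only [pairIdeal, Submodule.mem_iInf] at hf ⊢
  intro p hp
  refine mem_span_X_image_of_mul_X (j := j) ?_ (by rw [mul_comm]; exact hf p hp)
  simpa using hj p hp

theorem mem_pairIdeal_insert_iff [DecidableEq P] {S : Finset P} {q : P} (hq : q ∉ S)
    (f : MvPolynomial (P ⊕ P) K) :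
    f ∈ pairIdeal K (insert q S) ↔
      ∃ a ∈ pairIdeal K S, ∃ b ∈ pairIdeal K S,
        X (Sum.inl q) * a + X (Sum.inr q) * b = f := by
  have hins : pairIdeal K (insert q S) =
      Ideal.span (X '' {Sum.inl q, Sum.inr q}) ⊓ pairIdeal K S :=
    Finset.iInf_insert q S _
  constructor
  · intro hf
    have hfS : f ∈ pairIdeal K S := by
      rw [hins] at hf
      exact hf.2
    set r := f.modMonomial (Finsupp.single (Sum.inl q) 1) with hr
    have hfr : X (Sum.inl q) * (f.divMonomial (Finsupp.single (Sum.inl q) 1)) + r = f :=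
      divMonomial_add_modMonomial_single f (Sum.inl q)
    have hrsupp : ∀ m ∈ r.support, m ∈ f.support ∧ m (Sum.inl q) = 0 := by
      intro m hm
      have hm' : ¬ Finsupp.single (Sum.inl q) 1 ≤ m := fun h =>
        mem_support_iff.1 hm (coeff_modMonomial_of_le f h)
      rw [mem_support_iff, hr, coeff_modMonomial_of_not_le f hm', ← mem_support_iff] at hm
      refine ⟨hm, ?_⟩
      rw [Finsupp.single_le_iff] at hm'
      lia
    have hrS : r ∈ pairIdeal K S :=
      mem_pairIdeal_iff.2 fun m hm => mem_pairIdeal_iff.1 hfS m (hrsupp m hm).1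
    have hdvd : (X (Sum.inr q) : MvPolynomial (P ⊕ P) K) ∣ r := by
      rw [← Ideal.mem_span_singleton, ← Set.image_singleton, mem_ideal_span_X_image]
      intro m hm
      refine ⟨_, rfl, ?_⟩
      obtain ⟨hmf, hm0⟩ := hrsupp m hm
      exact (mem_pairIdeal_iff.1 hf m hmf q (Finset.mem_insert_self q S)).resolve_left
        (by simpa using hm0)
    obtain ⟨b, hb⟩ := hdvd
    refine ⟨_, mem_pairIdeal_of_X_mul_mem (j := Sum.inl q) ?_ ?_, b,
      mem_pairIdeal_of_X_mul_mem (j := Sum.inr q) ?_ (hb ▸ hrS), by rw [← hb, hfr]⟩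
    · exact fun p hp => ⟨fun h => hq (Sum.inl_injective h ▸ hp), Sum.inl_ne_inr⟩
    · rw [← eq_sub_iff_add_eq] at hfr
      rw [hfr]
      exact sub_mem hfS hrS
    · exact fun p hp => ⟨Sum.inr_ne_inl, fun h => hq (Sum.inr_injective h ▸ hp)⟩
  · rintro ⟨a, ha, b, hb, rfl⟩
    rw [hins]
    refine ⟨add_mem (Ideal.mul_mem_right _ _ (Ideal.subset_span ⟨_, by simp, rfl⟩))
      (Ideal.mul_mem_right _ _ (Ideal.subset_span ⟨_, by simp, rfl⟩)),
      add_mem (Ideal.mul_mem_left _ _ ha) (Ideal.mul_mem_left _ _ hb)⟩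

theorem exists_ext_pairIdeal_ne_zero (S : Finset P)
    (N : ModuleCat.{0} (MvPolynomial (P ⊕ P) K)) [Nontrivial N]
    (hN : ∀ p ∈ S, ∀ z : N, (X (Sum.inl p) : MvPolynomial (P ⊕ P) K) • z = 0 ∧
      (X (Sum.inr p) : MvPolynomial (P ⊕ P) K) • z = 0) :
    ∃ e : Ext (ModuleCat.of (MvPolynomial (P ⊕ P) K) (pairIdeal K S)) N S.card, e ≠ 0 := by
  classical
  induction S using Finset.induction_on with
  | empty =>
    obtain ⟨z, hz⟩ := exists_ne (0 : N)
    let f : pairIdeal K (∅ : Finset P) →ₗ[MvPolynomial (P ⊕ P) K] N :=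
      LinearMap.toSpanSingleton _ N z ∘ₗ (pairIdeal K ∅).subtype
    let g : ModuleCat.of _ (pairIdeal K (∅ : Finset P)) ⟶ N := ModuleCat.ofHom f
    refine ⟨Ext.mk₀ g, fun h => hz ?_⟩
    have h0 : g = 0 := Ext.homEquiv₀.symm.injective <| by
      rw [Ext.homEquiv₀_symm_apply, Ext.homEquiv₀_symm_apply, Ext.mk₀_zero]
      exact h
    have h1 : f = 0 := congrArg ModuleCat.Hom.hom h0
    simpa [f] using DFunLike.congr_fun h1 ⟨1, by simp [pairIdeal]⟩
  | insert q S hq ih =>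
    rw [Finset.card_insert_of_notMem hq]
    refine Ideal.exists_ext_succ_ne_zero (x := X (Sum.inl q)) (y := X (Sum.inr q)) ?_
      (mem_nonZeroDivisors_of_ne_zero (X_ne_zero _)) ?_ (mem_pairIdeal_insert_iff hq)
      (fun z => (hN q (Finset.mem_insert_self q S) z).1)
      (fun z => (hN q (Finset.mem_insert_self q S) z).2)
      (ih fun p hp => hN p (Finset.mem_insert_of_mem hp))
    · intro a b h
      refine ((X_prime (i := Sum.inr q)).dvd_or_dvd (Dvd.intro b h.symm)).resolve_left ?_
      rw [X_dvd_X]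
      exact Sum.inr_ne_inl
    · exact fun c hc => mem_pairIdeal_of_X_mul_mem (j := Sum.inr q)
        (fun p hp => ⟨Sum.inr_ne_inl, fun h => hq (Sum.inr_injective h ▸ hp)⟩) hc

variable [Fintype P] [DecidableEq P] [PartialOrder P]

theorem hibiIdeal_le_pairIdeal (S : Finset P) : hibiIdeal K P ≤ pairIdeal K S := by
  refine Ideal.span_le.2 ?_
  rintro _ ⟨I, -, rfl⟩
  simp only [pairIdeal, SetLike.mem_coe, Submodule.mem_iInf]
  intro p _
  by_cases hp : p ∈ I
  · exact Ideal.mem_of_dvd _ ((Finset.dvd_prod_of_mem _ hp).mul_right _)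
      (Ideal.subset_span ⟨Sum.inl p, by simp, rfl⟩)
  · exact Ideal.mem_of_dvd _ ((Finset.dvd_prod_of_mem _ (Finset.mem_compl.2 hp)).mul_left _)
      (Ideal.subset_span ⟨Sum.inr p, by simp, rfl⟩)

theorem prod_mul_mem_hibiIdeal {S : Finset P} (hS : IsAntichain (· ≤ ·) (S : Set P))
    {f : MvPolynomial (P ⊕ P) K} (hf : f ∈ pairIdeal K S) :
    (∏ p ∈ Sᶜ, X (Sum.inl p) * X (Sum.inr p)) * f ∈ hibiIdeal K P := by
  classical
  rw [f.as_sum, Finset.mul_sum]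
  refine sum_mem fun e he => ?_
  have he' := mem_pairIdeal_iff.1 hf e he
  let I : Finset P := {p | ∃ t ∈ S, e (Sum.inl t) ≠ 0 ∧ p ≤ t}
  have hI : IsLowerSet (I : Set P) := by
    intro a b hba ha
    obtain ⟨t, ht, het, hat⟩ := (Finset.mem_filter.1 ha).2
    exact Finset.mem_filter.2 ⟨Finset.mem_univ b, t, ht, het, hba.trans hat⟩
  refine Ideal.mem_of_dvd _ ?_ (Ideal.subset_span ⟨I, hI, rfl⟩)
  have h1 : (∏ p ∈ I, X (Sum.inl p)) * ∏ p ∈ Iᶜ, X (Sum.inr p) =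
      ∏ p, (if p ∈ I then X (Sum.inl p) else X (Sum.inr p) : MvPolynomial (P ⊕ P) K) := by
    rw [Finset.prod_ite]
    congr 2
    · ext; simp
    · ext; simp
  have h2 : (∏ p ∈ Sᶜ, X (Sum.inl p) * X (Sum.inr p)) * monomial e (coeff e f) =
      C (coeff e f) * ∏ p, (if p ∈ S then 1 else X (Sum.inl p) * X (Sum.inr p)) *
        (X (Sum.inl p) ^ e (Sum.inl p) * X (Sum.inr p) ^ e (Sum.inr p)) := by
    rw [monomial_eq, Finsupp.prod_fintype _ _ (by simp), Fintype.prod_sum_type,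
      ← Finset.prod_mul_distrib, mul_left_comm,
      Finset.prod_mul_distrib (f := fun p => if p ∈ S then 1 else _), Finset.prod_ite,
      Finset.prod_const_one, one_mul, show ({p | p ∉ S} : Finset P) = Sᶜ by ext; simp]
  rw [h1, h2]
  refine (Finset.prod_dvd_prod_of_dvd _ _ fun p _ => ?_).mul_left _
  by_cases hpS : p ∈ S
  · rw [if_pos hpS, one_mul]
    by_cases hpe : e (Sum.inl p) = 0
    · have hpI : p ∉ I := by
        intro h
        obtain ⟨t, ht, het, hpt⟩ := (Finset.mem_filter.1 h).2
        obtain rfl := hS.eq hpS ht hpt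
        exact het hpe
      rw [if_neg hpI]
      exact (dvd_pow_self _ ((he' p hpS).resolve_left (by simpa using hpe))).mul_left _
    · rw [if_pos (Finset.mem_filter.2 ⟨Finset.mem_univ p, p, hpS, hpe, le_rfl⟩)]
      exact (dvd_pow_self _ hpe).mul_right _
  · rw [if_neg hpS]
    refine Dvd.dvd.mul_right ?_ _
    split_ifs
    · exact dvd_mul_right _ _
    · exact dvd_mul_left _ _

theorem IsAntichain.not_hasProjectiveDimensionLT_hibiIdeal {S : Finset P}
    (hS : IsAntichain (· ≤ ·) (S : Set P)) :
    ¬ HasProjectiveDimensionLT (ModuleCat.of (MvPolynomial (P ⊕ P) K) (hibiIdeal K P))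
      S.card := by
  intro hlt
  let v : P → K := fun p => if p ∈ S then 0 else 1
  let φ : MvPolynomial (P ⊕ P) K →+* K := eval (Sum.elim v v)
  let := Module.compHom K φ
  have hsmul : ∀ (r : MvPolynomial (P ⊕ P) K) (z : K), r • z = φ r * z := fun _ _ => rfl
  let N := ModuleCat.of (MvPolynomial (P ⊕ P) K) K
  have : Nontrivial N := inferInstanceAs (Nontrivial K)
  have hN : ∀ p ∈ S, ∀ z : N, (X (Sum.inl p) : MvPolynomial (P ⊕ P) K) • z = 0 ∧
      (X (Sum.inr p) : MvPolynomial (P ⊕ P) K) • z = 0 := fun p hp z =>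
    ⟨(hsmul _ z).trans (by simp [φ, v, hp]), (hsmul _ z).trans (by simp [φ, v, hp])⟩
  obtain ⟨e, he⟩ := Ideal.exists_ext_ne_zero_of_le (hibiIdeal_le_pairIdeal S) _
    (fun f hf => prod_mul_mem_hibiIdeal hS hf)
    (fun z : N => (hsmul _ z).trans (by
      rw [map_prod, Finset.prod_eq_one, one_mul]
      intro p hp
      simp [φ, v, Finset.mem_compl.1 hp]))
    (exists_ext_pairIdeal_ne_zero S N hN)
  exact he (e.eq_zero_of_hasProjectiveDimensionLT _ le_rfl)

end LowerBound

/-- **(Herzog–Hibi.)** For a finite poset `P` and field `K`, the projective dimension of the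
Hibi ideal `H_P` as a module over `R = K[xₚ, yₚ : p ∈ P]` equals the Dilworth number of `P`,
the maximum cardinality of an antichain in `P`.  Here the projective dimension is expressed
as the least `n` such that `H_P` admits a projective resolution vanishing in homological
degrees greater than `n`, and `d` is the greatest cardinality of an antichain of `P`. -/
theorem hibiIdeal_projectiveDimension_eq_dilworthNumber
    (P : Type) [Fintype P] [PartialOrder P] [DecidableEq P] (K : Type) [Field K] (d : ℕ)
    (hd : IsGreatest {k : ℕ | ∃ S : Finset P,
            IsAntichain (· ≤ ·) (S : Set P) ∧ S.card = k} d) :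
    IsLeast {n : ℕ |
      ∃ Pr : ProjectiveResolution
          (ModuleCat.of (MvPolynomial (P ⊕ P) K) (hibiIdeal K P)),
        ∀ k : ℕ, n < k → Limits.IsZero (Pr.complex.X k)} d := by
  obtain ⟨⟨S, hS, rfl⟩, hmax⟩ := hd
  refine ⟨?_, fun n ⟨Pr, hPr⟩ => ?_⟩
  · have := hasProjectiveDimensionLE_hibiIdeal K fun T hT => hmax ⟨T, hT, rfl⟩
    exact HasProjectiveDimensionLE.exists_projectiveResolution S.card _
  · by_contra! hn
    have := Pr.hasProjectiveDimensionLE hPr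
    exact hS.not_hasProjectiveDimensionLT_hibiIdeal (K := K)
      (hasProjectiveDimensionLT_of_ge _ (n + 1) _ hn)
end
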